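/- Let x = x̂ ⊗ t_λ ⊗ z_{−∞} with x̂ = (…, x_2, x_1) ∈ X+, and suppose that x* is extremal. Then for every k ≥ 1 one has p_k − x_k ≥ 0 and, setting μ := −λ − wt(x̂), S_{w_k}(x*) = ẽ_{i_k}^{x_k} ⋯ ẽ_{i_2}^{x_2} ẽ_{i_1}^{x_1}(x̂*) ⊗ t_μ ⊗ ẽ_{i_k}^{p_k−x_k} ⋯ ẽ_{i_2}^{p_2−x_2} ẽ_{i_1}^{p_1−x_1}(z_{−∞}). -/

import Mathlib

open Filter Function

namespace HypCrystal

variable (a1 a2 k1 k2 : ℤ)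

/-- `i_k`: 1 if `k` is odd, 2 if `k` is even. -/
def idx (k : ℤ) : ℤ := if k % 2 = 1 then 1 else 2

/-- membership in the index set `I = {1,2}`. -/
def IsI (i : ℤ) : Prop := i = 1 ∨ i = 2

/-- `⟨α_{i_j}, α_{i_k}^∨⟩`. -/
def pairJK (j k : ℤ) : ℤ :=
  if j % 2 = k % 2 then 2 else if k % 2 = 1 then -a1 else -a2

/-- `⟨α_{i_j}, α_i^∨⟩` for `i ∈ {1,2}`. -/
def pairJI (j i : ℤ) : ℤ :=
  if idx j = i then 2 else if i = 1 then -a1 else -a2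

/-- `α_{i_j}` in the `(Λ1, Λ2)`-coordinates. -/
def alphaOf (j : ℤ) : ℤ × ℤ := if j % 2 = 1 then (2, -a2) else (-a1, 2)

/-- `⟨ν, α_i^∨⟩` for a weight `ν` in `(Λ1, Λ2)`-coordinates. -/
def pairW (ν : ℤ × ℤ) (i : ℤ) : ℤ := if i = 1 then ν.1 else ν.2

/-- the sequence `c_j`. -/
def cseq : ℕ → ℤ
  | 0 => 0
  | 1 => 1
  | j + 2 => (if j % 2 = 0 then a1 else a2) * cseq (j + 1) - cseq j

/-- the sequence `c'_j`. -/
def cseq' : ℕ → ℤ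
  | 0 => 0
  | 1 => 1
  | j + 2 => (if j % 2 = 0 then a2 else a1) * cseq' (j + 1) - cseq' j

noncomputable def alphaR : ℝ :=
  ((a1 : ℝ) * a2 + Real.sqrt ((a1 : ℝ) ^ 2 * (a2 : ℝ) ^ 2 - 4 * a1 * a2)) / (2 * a2)

noncomputable def betaR : ℝ :=
  ((a1 : ℝ) * a2 + Real.sqrt ((a1 : ℝ) ^ 2 * (a2 : ℝ) ^ 2 - 4 * a1 * a2)) / (2 * a1)

/-- `γ_k = α` if `k` even, `β` if `k` odd. -/
noncomputable def gammaR (k : ℤ) : ℝ := if k % 2 = 0 then alphaR a1 a2 else betaR a1 a2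

/-- `p_m` for `m ≥ 0`. -/
def ppos : ℕ → ℤ
  | 0 => k2
  | 1 => k1
  | m + 2 => (if m % 2 = 0 then a2 else a1) * ppos (m + 1) - ppos m

/-- `p_{-n}` for `n ≥ 0`. -/
def pneg : ℕ → ℤ
  | 0 => k2
  | 1 => a1 * k2 - k1
  | n + 2 => (if (n + 2) % 2 = 0 then a2 else a1) * pneg (n + 1) - pneg n

/-- the two-sided sequence `p_m`, `m ∈ ℤ`, with `p_0 = k2`, `p_1 = k1`. -/
def pseq (m : ℤ) : ℤ :=
  if 0 ≤ m then ppos a1 a2 k1 k2 m.toNat else pneg a1 a2 k1 k2 (-m).toNat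

/-- `λ = k1·Λ1 − k2·Λ2` in `(Λ1, Λ2)`-coordinates. -/
def lamW : ℤ × ℤ := (k1, -k2)

/-- membership in `ℤ^{+∞}` (coordinates supported on positions `≥ 1`, nonnegative,
finitely supported). -/
def ZPlusMem (x : ℤ → ℤ) : Prop :=
  (∀ k : ℤ, k ≤ 0 → x k = 0) ∧ (∀ k : ℤ, 0 ≤ x k) ∧ ∃ N : ℕ, ∀ k : ℤ, (N : ℤ) < k → x k = 0

/-- membership in `ℤ^{−∞}` (coordinates supported on positions `≤ 0`, nonpositive,
finitely supported). -/
def ZMinusMem (x : ℤ → ℤ) : Prop :=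
  (∀ k : ℤ, 1 ≤ k → x k = 0) ∧ (∀ k : ℤ, x k ≤ 0) ∧ ∃ N : ℕ, ∀ k : ℤ, k < -(N : ℤ) → x k = 0

/-- membership in `X+ = Img(Ψ⁺)`. -/
def XPlusMem (x : ℤ → ℤ) : Prop :=
  ZPlusMem x ∧ ∀ j : ℤ, 1 ≤ j →
    0 ≤ cseq a1 a2 j.toNat * x j - cseq a1 a2 (j - 1).toNat * x (j + 1)

/-- membership in `X− = Img(Ψ⁻)`. -/
def XMinusMem (x : ℤ → ℤ) : Prop :=
  ZMinusMem x ∧ ∀ j : ℤ, j ≤ 0 →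
    cseq' a1 a2 (1 - j).toNat * x j - cseq' a1 a2 (-j).toNat * x (j - 1) ≤ 0

def posPart (x : ℤ → ℤ) : ℤ → ℤ := fun k => if 1 ≤ k then x k else 0
def negPart (x : ℤ → ℤ) : ℤ → ℤ := fun k => if k ≤ 0 then x k else 0

/-- membership in `Z_ι(μ) = ℤ^{+∞} ⊗ t_μ ⊗ ℤ^{−∞}` (in coordinates). -/
def ZMem (x : ℤ → ℤ) : Prop := ZPlusMem (posPart x) ∧ ZMinusMem (negPart x)

/-- membership in `X+ ⊗ t_λ ⊗ X−` (in coordinates). -/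
def XXMem (x : ℤ → ℤ) : Prop := XPlusMem a1 a2 (posPart x) ∧ XMinusMem a1 a2 (negPart x)

/-- `σ_k` on `ℤ^{+∞}` (for `k ≥ 1`). -/
noncomputable def sigmaP (x : ℤ → ℤ) (k : ℤ) : ℤ :=
  x k + ∑ᶠ j : ℤ, if k < j then pairJK a1 a2 j k * x j else 0

/-- `σ_k` on `ℤ^{−∞}` (for `k ≤ 0`). -/
noncomputable def sigmaM (x : ℤ → ℤ) (k : ℤ) : ℤ :=
  -(x k) - ∑ᶠ j : ℤ, if j < k then pairJK a1 a2 j k * x j else 0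

/-- `−Σ_j x_j α_{i_j}` in `(Λ1, Λ2)`-coordinates. -/
noncomputable def wtOf (x : ℤ → ℤ) : ℤ × ℤ :=
  (-∑ᶠ j : ℤ, x j * (alphaOf a1 a2 j).1, -∑ᶠ j : ℤ, x j * (alphaOf a1 a2 j).2)

/-- `wt(x) = μ − Σ_j x_j α_{i_j}`. -/
noncomputable def wtZ (μ : ℤ × ℤ) (x : ℤ → ℤ) : ℤ × ℤ := μ + wtOf a1 a2 x

/-- `σ_k` on `Z_ι(μ)`. -/
noncomputable def sigmaZ (μ : ℤ × ℤ) (x : ℤ → ℤ) (k : ℤ) : ℤ :=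
  if 1 ≤ k then sigmaP a1 a2 x k
  else sigmaM a1 a2 x k - pairW (wtZ a1 a2 μ x) (idx k)

/-- `ε_i` on `Z_ι(μ)`. -/
noncomputable def epsZ (μ : ℤ × ℤ) (x : ℤ → ℤ) (i : ℤ) : ℤ :=
  sSup {s : ℤ | ∃ k : ℤ, idx k = i ∧ sigmaZ a1 a2 μ x k = s}

/-- `φ_i` on `Z_ι(μ)`. -/
noncomputable def phiZ (μ : ℤ × ℤ) (x : ℤ → ℤ) (i : ℤ) : ℤ :=
  epsZ a1 a2 μ x i + pairW (wtZ a1 a2 μ x) i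

noncomputable def kmaxZ (μ : ℤ × ℤ) (x : ℤ → ℤ) (i : ℤ) : ℤ :=
  sSup {k : ℤ | idx k = i ∧ sigmaZ a1 a2 μ x k = epsZ a1 a2 μ x i}

noncomputable def kminZ (μ : ℤ × ℤ) (x : ℤ → ℤ) (i : ℤ) : ℤ :=
  sInf {k : ℤ | idx k = i ∧ sigmaZ a1 a2 μ x k = epsZ a1 a2 μ x i}

/-- `ẽ_i` on `Z_ι(μ)`; `none` represents `0`. -/
noncomputable def eZ (μ : ℤ × ℤ) (i : ℤ) (x : ℤ → ℤ) : Option (ℤ → ℤ) :=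
  if 0 < epsZ a1 a2 μ x i then
    some (Function.update x (kmaxZ a1 a2 μ x i) (x (kmaxZ a1 a2 μ x i) - 1))
  else none

/-- `f̃_i` on `Z_ι(μ)`; `none` represents `0`. -/
noncomputable def fZ (μ : ℤ × ℤ) (i : ℤ) (x : ℤ → ℤ) : Option (ℤ → ℤ) :=
  if 0 < phiZ a1 a2 μ x i then
    some (Function.update x (kminZ a1 a2 μ x i) (x (kminZ a1 a2 μ x i) + 1))
  else none

/-- `ε_i` on `ℤ^{+∞}`. -/
noncomputable def epsP (x : ℤ → ℤ) (i : ℤ) : ℤ :=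
  sSup {s : ℤ | ∃ k : ℤ, 1 ≤ k ∧ idx k = i ∧ sigmaP a1 a2 x k = s}

noncomputable def kmaxP (x : ℤ → ℤ) (i : ℤ) : ℤ :=
  sSup {k : ℤ | 1 ≤ k ∧ idx k = i ∧ sigmaP a1 a2 x k = epsP a1 a2 x i}

noncomputable def kminP (x : ℤ → ℤ) (i : ℤ) : ℤ :=
  sInf {k : ℤ | 1 ≤ k ∧ idx k = i ∧ sigmaP a1 a2 x k = epsP a1 a2 x i}

/-- `ẽ_i` on `ℤ^{+∞}` (partial). -/
noncomputable def eP (i : ℤ) (x : ℤ → ℤ) : Option (ℤ → ℤ) :=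
  if 0 < epsP a1 a2 x i then
    some (Function.update x (kmaxP a1 a2 x i) (x (kmaxP a1 a2 x i) - 1))
  else none

/-- `f̃_i` on `ℤ^{+∞}` (total). -/
noncomputable def fP (i : ℤ) (x : ℤ → ℤ) : ℤ → ℤ :=
  Function.update x (kminP a1 a2 x i) (x (kminP a1 a2 x i) + 1)

/-- `φ_i` on `ℤ^{−∞}`. -/
noncomputable def phiMf (x : ℤ → ℤ) (i : ℤ) : ℤ :=
  sSup {s : ℤ | ∃ k : ℤ, k ≤ 0 ∧ idx k = i ∧ sigmaM a1 a2 x k = s}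

noncomputable def kmaxM (x : ℤ → ℤ) (i : ℤ) : ℤ :=
  sSup {k : ℤ | k ≤ 0 ∧ idx k = i ∧ sigmaM a1 a2 x k = phiMf a1 a2 x i}

noncomputable def kminM (x : ℤ → ℤ) (i : ℤ) : ℤ :=
  sInf {k : ℤ | k ≤ 0 ∧ idx k = i ∧ sigmaM a1 a2 x k = phiMf a1 a2 x i}

/-- `ẽ_i` on `ℤ^{−∞}` (total). -/
noncomputable def eM (i : ℤ) (x : ℤ → ℤ) : ℤ → ℤ :=
  Function.update x (kmaxM a1 a2 x i) (x (kmaxM a1 a2 x i) - 1)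

noncomputable def fPiter (i : ℤ) (n : ℕ) (x : ℤ → ℤ) : ℤ → ℤ := (fP a1 a2 i)^[n] x

noncomputable def eMiter (i : ℤ) (n : ℕ) (x : ℤ → ℤ) : ℤ → ℤ := (eM a1 a2 i)^[n] x

noncomputable def ePiterO (i : ℤ) (n : ℕ) (ox : Option (ℤ → ℤ)) : Option (ℤ → ℤ) :=
  (fun o => o.bind (eP a1 a2 i))^[n] ox

noncomputable def eZiterO (μ : ℤ × ℤ) (i : ℤ) (n : ℕ) (ox : Option (ℤ → ℤ)) : Option (ℤ → ℤ) :=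
  (fun o => o.bind (eZ a1 a2 μ i))^[n] ox

noncomputable def fZiterO (μ : ℤ × ℤ) (i : ℤ) (n : ℕ) (ox : Option (ℤ → ℤ)) : Option (ℤ → ℤ) :=
  (fun o => o.bind (fZ a1 a2 μ i))^[n] ox

noncomputable def suppBoundP (x : ℤ → ℤ) : ℕ := sInf {N : ℕ | ∀ k : ℤ, (N : ℤ) < k → x k = 0}

noncomputable def suppBoundM (x : ℤ → ℤ) : ℕ := sInf {N : ℕ | ∀ k : ℤ, k < -(N : ℤ) → x k = 0}

/-- `starPChain x n z = f̃_{i_1}^{x_1} ⋯ f̃_{i_n}^{x_n} (z)` on `ℤ^{+∞}`. -/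
noncomputable def starPChain (x : ℤ → ℤ) : ℕ → (ℤ → ℤ) → (ℤ → ℤ)
  | 0, z => z
  | n + 1, z => starPChain x n (fPiter a1 a2 (idx ((n : ℤ) + 1)) ((x ((n : ℤ) + 1)).toNat) z)

/-- the `∗`-operation on `X+`: `(x⁺)* = f̃_{i_1}^{x_1} ⋯ f̃_{i_N}^{x_N} (z_∞)`. -/
noncomputable def starP (x : ℤ → ℤ) : ℤ → ℤ :=
  starPChain a1 a2 x (suppBoundP x) (fun _ => 0)

/-- `starMChain x n z = ẽ_{i_0}^{−x_0} ⋯ ẽ_{i_{-(n-1)}}^{−x_{-(n-1)}} (z)` on `ℤ^{−∞}`. -/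
noncomputable def starMChain (x : ℤ → ℤ) : ℕ → (ℤ → ℤ) → (ℤ → ℤ)
  | 0, z => z
  | n + 1, z => starMChain x n (eMiter a1 a2 (idx (-(n : ℤ))) ((-(x (-(n : ℤ)))).toNat) z)

/-- the `∗`-operation on `X−`. -/
noncomputable def starM (x : ℤ → ℤ) : ℤ → ℤ :=
  starMChain a1 a2 x (suppBoundM x + 1) (fun _ => 0)

/-- combine a `ℤ^{+∞}`- and a `ℤ^{−∞}`-component into an element of `Z_ι(μ)`. -/
def combine (y z : ℤ → ℤ) : ℤ → ℤ := fun k => if 1 ≤ k then y k else z k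

/-- the coordinates of `x* = (x⁺)* ⊗ t_μ ⊗ (x⁻)*`. -/
noncomputable def xstarFun (x : ℤ → ℤ) : ℤ → ℤ :=
  combine (starP a1 a2 (posPart x)) (starM a1 a2 (negPart x))

/-- the weight `μ = −λ − wt(x⁺) − wt(x⁻)` of `x*`. -/
noncomputable def mustar (lam : ℤ × ℤ) (x : ℤ → ℤ) : ℤ × ℤ :=
  -lam - wtOf a1 a2 (posPart x) - wtOf a1 a2 (negPart x)

/-- `fPnegChain g n z = f̃_{i_{-(n-1)}}^{g(-(n-1))} ⋯ f̃_{i_{-1}}^{g(-1)} f̃_{i_0}^{g 0} (z)`. -/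
noncomputable def fPnegChain (g : ℤ → ℕ) : ℕ → (ℤ → ℤ) → (ℤ → ℤ)
  | 0, z => z
  | n + 1, z => fPiter a1 a2 (idx (-(n : ℤ))) (g (-(n : ℤ))) (fPnegChain g n z)

/-- `eMposChain g n z = ẽ_{i_n}^{g n} ⋯ ẽ_{i_2}^{g 2} ẽ_{i_1}^{g 1} (z)`. -/
noncomputable def eMposChain (g : ℤ → ℕ) : ℕ → (ℤ → ℤ) → (ℤ → ℤ)
  | 0, z => z
  | n + 1, z => eMiter a1 a2 (idx ((n : ℤ) + 1)) (g ((n : ℤ) + 1)) (eMposChain g n z)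

/-- `ePposChainO g n z = ẽ_{i_n}^{g n} ⋯ ẽ_{i_2}^{g 2} ẽ_{i_1}^{g 1} (z)` on `ℤ^{+∞}`. -/
noncomputable def ePposChainO (g : ℤ → ℕ) : ℕ → Option (ℤ → ℤ) → Option (ℤ → ℤ)
  | 0, z => z
  | n + 1, z => ePiterO a1 a2 (idx ((n : ℤ) + 1)) (g ((n : ℤ) + 1)) (ePposChainO g n z)

/-- the Weyl group action `S_i` on `Z_ι(μ) ∪ {0}`. -/
noncomputable def SiO (μ : ℤ × ℤ) (i : ℤ) (ob : Option (ℤ → ℤ)) : Option (ℤ → ℤ) :=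
  ob.bind fun b =>
    if 0 ≤ pairW (wtZ a1 a2 μ b) i then
      fZiterO a1 a2 μ i (pairW (wtZ a1 a2 μ b) i).toNat (some b)
    else eZiterO a1 a2 μ i (-(pairW (wtZ a1 a2 μ b) i)).toNat (some b)

/-- `SwPos μ n = S_{i_n} ⋯ S_{i_2} S_{i_1}`. -/
noncomputable def SwPos (μ : ℤ × ℤ) : ℕ → Option (ℤ → ℤ) → Option (ℤ → ℤ)
  | 0, b => b
  | n + 1, b => SiO a1 a2 μ (idx ((n : ℤ) + 1)) (SwPos μ n b)

/-- `SwNeg μ n = S_{i_{-(n-1)}} ⋯ S_{i_{-1}} S_{i_0}`. -/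
noncomputable def SwNeg (μ : ℤ × ℤ) : ℕ → Option (ℤ → ℤ) → Option (ℤ → ℤ)
  | 0, b => b
  | n + 1, b => SiO a1 a2 μ (idx (-(n : ℤ))) (SwNeg μ n b)

/-- `S_{w_k}`. -/
noncomputable def Swk (μ : ℤ × ℤ) (k : ℤ) (b : Option (ℤ → ℤ)) : Option (ℤ → ℤ) :=
  if 0 ≤ k then SwPos a1 a2 μ k.toNat b else SwNeg a1 a2 μ (-k).toNat b

/-- `b ∈ Z_ι(μ)` is extremal. -/
noncomputable def Extremal (μ : ℤ × ℤ) (b : ℤ → ℤ) : Prop :=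
  ∀ js : List ℤ, (∀ j ∈ js, IsI j) →
    ∃ b', js.foldr (SiO a1 a2 μ) (some b) = some b' ∧
      ∀ i : ℤ, IsI i →
        (0 ≤ pairW (wtZ a1 a2 μ b') i → eZ a1 a2 μ i b' = none) ∧
        (pairW (wtZ a1 a2 μ b') i ≤ 0 → fZ a1 a2 μ i b' = none)

/-- `φ(x) ≥ 0` for all `φ ∈ Ξ_ι[λ]`. -/
noncomputable def SigmaCond (x : ℤ → ℤ) : Prop :=
  (0 ≤ gammaR a1 a2 0 * (pseq a1 a2 k1 k2 0 : ℝ) + gammaR a1 a2 0 * (x 0 : ℝ) - (x 1 : ℝ)) ∧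
  (0 ≤ gammaR a1 a2 1 * (pseq a1 a2 k1 k2 1 : ℝ) + (x 0 : ℝ) - gammaR a1 a2 1 * (x 1 : ℝ)) ∧
  (∀ k : ℤ, 1 ≤ k → 0 ≤ (pseq a1 a2 k1 k2 k : ℝ) - (x k : ℝ)) ∧
  (∀ k : ℤ, 1 ≤ k → 0 ≤ gammaR a1 a2 k * (x k : ℝ) - (x (k + 1) : ℝ)) ∧
  (∀ k : ℤ, 1 ≤ k → 0 ≤ gammaR a1 a2 (k + 1) * (pseq a1 a2 k1 k2 (k + 1) : ℝ) -
      (pseq a1 a2 k1 k2 k : ℝ) + (x k : ℝ) - gammaR a1 a2 (k + 1) * (x (k + 1) : ℝ)) ∧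
  (∀ k : ℤ, k ≤ 0 → 0 ≤ (pseq a1 a2 k1 k2 k : ℝ) + (x k : ℝ)) ∧
  (∀ k : ℤ, k ≤ 0 → 0 ≤ (x (k - 1) : ℝ) - gammaR a1 a2 k * (x k : ℝ)) ∧
  (∀ k : ℤ, k ≤ 0 → 0 ≤ gammaR a1 a2 (k - 1) * (pseq a1 a2 k1 k2 (k - 1) : ℝ) -
      (pseq a1 a2 k1 k2 k : ℝ) + gammaR a1 a2 (k - 1) * (x (k - 1) : ℝ) - (x k : ℝ))

/-- membership in `Σ_ι[λ]`. -/
noncomputable def SigmaMem (x : ℤ → ℤ) : Prop :=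
  ZMem x ∧ SigmaCond a1 a2 k1 k2 x

/-- membership in `Σ'_ι[λ]`. -/
noncomputable def SigmaPrimeMem (x : ℤ → ℤ) : Prop :=
  SigmaMem a1 a2 k1 k2 x ∧ (∀ k : ℤ, k ≤ 0 → x k = 0) ∧ XPlusMem a1 a2 (posPart x)

/-- evaluation of an affine function `φ = (c, (φ_l)_l)` at `x`. -/
noncomputable def evalAff (φ : ℝ × (ℤ → ℝ)) (x : ℤ → ℤ) : ℝ :=
  φ.1 + ∑ᶠ l : ℤ, φ.2 l * (x l : ℝ)

/-- `a_{i_k}`. -/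
def aIdx (k : ℤ) : ℤ := if k % 2 = 1 then a1 else a2

/-- the affine function `b̄_k`. -/
noncomputable def bbar (lam : ℤ × ℤ) (k : ℤ) : ℝ × (ℤ → ℝ) :=
  ((if k = -1 ∨ k = 0 then -(pairW lam (idx k) : ℝ) else 0),
    fun l => (if l = k then (1 : ℝ) else 0) + (if l = k + 1 then -(aIdx a1 a2 k : ℝ) else 0) +
      (if l = k + 2 then (1 : ℝ) else 0))

/-- the operator `S̄_k` on affine functions. -/
noncomputable def SbarOp (lam : ℤ × ℤ) (k : ℤ) (φ : ℝ × (ℤ → ℝ)) : ℝ × (ℤ → ℝ) :=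
  let b := if 0 ≤ φ.2 k then bbar a1 a2 lam (k + 2) else bbar a1 a2 lam (k - 2)
  (φ.1 - φ.2 k * b.1, fun l => φ.2 l - φ.2 k * b.2 l)

end HypCrystal

namespace HypCrystal

variable (a1 a2 : ℤ)

/-- The linear form with coefficients `c`. -/
noncomputable def linForm (c x : ℤ → ℤ) : ℤ := ∑ᶠ j : ℤ, c j * x j

lemma linForm_eq_sum (c : ℤ → ℤ) {x : ℤ → ℤ} {s : Finset ℤ} (hs : x.support ⊆ s) :
    linForm c x = ∑ j ∈ s, c j * x j := by
  refine finsum_eq_sum_of_support_subset _ fun j hj => hs ?_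
  intro h
  exact hj (by simp [h])

lemma linForm_update (c : ℤ → ℤ) {x : ℤ → ℤ} (hx : x.support.Finite) (m v : ℤ) :
    linForm c (update x m v) = linForm c x + c m * (v - x m) := by
  classical
  have h1 : x.support ⊆ (insert m hx.toFinset : Finset ℤ) := by
    intro j hj
    simp_all
  have h2 : (update x m v).support ⊆ (insert m hx.toFinset : Finset ℤ) := by
    intro j hj
    by_cases hjm : j = m
    · simp [hjm]
    · simp_all
  rw [linForm_eq_sum c h1, linForm_eq_sum c h2, ← sub_eq_iff_eq_add', ← Finset.sum_sub_distrib,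
    Finset.sum_eq_single m]
  · simp; ring
  · intro b _ hb
    simp [hb]
  · simp

lemma linForm_add_coeff (c d : ℤ → ℤ) {x : ℤ → ℤ} (hx : x.support.Finite) :
    linForm (fun j => c j + d j) x = linForm c x + linForm d x := by
  have h : x.support ⊆ hx.toFinset := by simp
  simp only [linForm_eq_sum _ h, ← Finset.sum_add_distrib, add_mul]

lemma linForm_mul_coeff (r : ℤ) (c : ℤ → ℤ) {x : ℤ → ℤ} (hx : x.support.Finite) :
    linForm (fun j => r * c j) x = r * linForm c x := by
  have h : x.support ⊆ hx.toFinset := by simp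
  simp only [linForm_eq_sum _ h, Finset.mul_sum, mul_assoc]

lemma linForm_eq_zero {c x : ℤ → ℤ} (h : ∀ j, c j = 0 ∨ x j = 0) : linForm c x = 0 := by
  unfold linForm
  rw [finsum_eq_zero_of_forall_eq_zero]
  intro j
  rcases h j with h | h <;> simp [h]

lemma linForm_single (k : ℤ) (r : ℤ) (x : ℤ → ℤ) :
    linForm (fun j => if j = k then r else 0) x = r * x k := by
  unfold linForm
  rw [finsum_eq_single _ k]
  · simp
  · intro j hj
    simp [hj]

lemma support_update_finite {x : ℤ → ℤ} (hx : x.support.Finite) (m v : ℤ) :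
    (update x m v).support.Finite := by
  refine (hx.union (Set.finite_singleton m)).subset fun j hj => ?_
  by_cases hjm : j = m <;> simp_all

lemma idx_eq_idx {j k : ℤ} : idx j = idx k ↔ j % 2 = k % 2 := by
  unfold idx
  split_ifs <;> omega

lemma isI_idx (k : ℤ) : IsI (idx k) := by
  unfold IsI idx
  split_ifs <;> simp

/-- The coefficients of `σ_k` on `ℤ^{+∞}`. -/
def coeffP (k j : ℤ) : ℤ := if j = k then 1 else if k < j then pairJK a1 a2 j k else 0

/-- The coefficients of `σ_k` on `ℤ^{−∞}`. -/
def coeffM (k j : ℤ) : ℤ := if j = k then -1 else if j < k then -pairJK a1 a2 j k else 0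

lemma sigmaP_eq_linForm {x : ℤ → ℤ} (hx : x.support.Finite) (k : ℤ) :
    sigmaP a1 a2 x k = linForm (coeffP a1 a2 k) x := by
  have h : coeffP a1 a2 k = fun j => (if j = k then 1 else 0) +
      (if k < j then pairJK a1 a2 j k else 0) := by
    funext j
    unfold coeffP
    split_ifs <;> omega
  rw [h, linForm_add_coeff _ _ hx, linForm_single, one_mul]
  simp only [sigmaP, linForm, ite_mul, zero_mul]

lemma sigmaM_eq_linForm {x : ℤ → ℤ} (hx : x.support.Finite) (k : ℤ) :
    sigmaM a1 a2 x k = linForm (coeffM a1 a2 k) x := by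
  have h : coeffM a1 a2 k = fun j => (if j = k then -1 else 0) +
      (-1) * (if j < k then pairJK a1 a2 j k else 0) := by
    funext j
    unfold coeffM
    split_ifs <;> omega
  rw [h, linForm_add_coeff _ _ hx, linForm_single, linForm_mul_coeff _ _ hx]
  simp only [sigmaM, linForm, ite_mul, zero_mul]
  ring

lemma sigmaP_update {x : ℤ → ℤ} (hx : x.support.Finite) (m v k : ℤ) :
    sigmaP a1 a2 (update x m v) k = sigmaP a1 a2 x k + coeffP a1 a2 k m * (v - x m) := by
  rw [sigmaP_eq_linForm _ _ hx, sigmaP_eq_linForm _ _ (support_update_finite hx m v),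
    linForm_update _ hx]

lemma sigmaM_update {x : ℤ → ℤ} (hx : x.support.Finite) (m v k : ℤ) :
    sigmaM a1 a2 (update x m v) k = sigmaM a1 a2 x k + coeffM a1 a2 k m * (v - x m) := by
  rw [sigmaM_eq_linForm _ _ hx, sigmaM_eq_linForm _ _ (support_update_finite hx m v),
    linForm_update _ hx]

/-- A bound for the absolute values of the positions in a finite support. -/
lemma exists_support_bound {x : ℤ → ℤ} (hx : x.support.Finite) :
    ∃ N : ℤ, 0 ≤ N ∧ ∀ k, x k ≠ 0 → |k| ≤ N := by
  obtain ⟨N, hN⟩ := (hx.image abs).bddAbove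
  refine ⟨max N 0, le_max_right _ _, fun k hk => le_max_of_le_left (hN ⟨k, hk, rfl⟩)⟩

lemma sigmaP_eventually_zero {x : ℤ → ℤ} (hx : x.support.Finite) :
    ∃ N : ℤ, 0 ≤ N ∧ ∀ k, N < k → sigmaP a1 a2 x k = 0 := by
  obtain ⟨N, h0, hN⟩ := exists_support_bound hx
  refine ⟨N, h0, fun k hk => ?_⟩
  rw [sigmaP_eq_linForm _ _ hx]
  refine linForm_eq_zero fun j => ?_
  by_cases hj : x j = 0
  · exact Or.inr hj
  · have := abs_le.mp (hN j hj)
    left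
    unfold coeffP
    rw [if_neg (by omega), if_neg (by omega)]

lemma sigmaM_eventually_zero {x : ℤ → ℤ} (hx : x.support.Finite) :
    ∃ N : ℤ, 0 ≤ N ∧ ∀ k, k < -N → sigmaM a1 a2 x k = 0 := by
  obtain ⟨N, h0, hN⟩ := exists_support_bound hx
  refine ⟨N, h0, fun k hk => ?_⟩
  rw [sigmaM_eq_linForm _ _ hx]
  refine linForm_eq_zero fun j => ?_
  by_cases hj : x j = 0
  · exact Or.inr hj
  · have := abs_le.mp (hN j hj)
    left
    unfold coeffM
    rw [if_neg (by omega), if_neg (by omega)]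

/-- An integer function bounded on a set away from finitely many points has bounded values. -/
lemma bddAbove_values {f : ℤ → ℤ} {A : Set ℤ} (hA : A.Finite) {K : ℤ → Prop} {r : ℤ}
    (h : ∀ k, K k → k ∉ A → f k = r) : BddAbove {s : ℤ | ∃ k, K k ∧ f k = s} := by
  refine ((hA.image f).union (Set.finite_singleton r)).bddAbove.mono ?_
  rintro s ⟨k, hk, rfl⟩
  by_cases hkA : k ∈ A
  · exact Or.inl ⟨k, hkA, rfl⟩
  · exact Or.inr (h k hk hkA)

lemma idx_exists_gt (s N : ℤ) : ∃ k, N < k ∧ idx k = idx s := by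
  refine ⟨s + 2 * (|N| + |s| + 1), ?_, ?_⟩
  · have := neg_abs_le s
    have := le_abs_self N
    have := abs_nonneg N
    have := abs_nonneg s
    omega
  · rw [idx_eq_idx]; omega

lemma idx_exists_lt (s N : ℤ) : ∃ k, k < N ∧ idx k = idx s := by
  refine ⟨s - 2 * (|N| + |s| + 1), ?_, ?_⟩
  · have := le_abs_self s
    have := neg_abs_le N
    have := abs_nonneg N
    have := abs_nonneg s
    omega
  · rw [idx_eq_idx]; omega

lemma epsP_spec {y : ℤ → ℤ} (hy : y.support.Finite) (s : ℤ) :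
    (∃ k, 1 ≤ k ∧ idx k = idx s ∧ sigmaP a1 a2 y k = epsP a1 a2 y (idx s)) ∧
    (∀ k, 1 ≤ k → idx k = idx s → sigmaP a1 a2 y k ≤ epsP a1 a2 y (idx s)) ∧
    0 ≤ epsP a1 a2 y (idx s) := by
  obtain ⟨N, h0, hN⟩ := sigmaP_eventually_zero a1 a2 hy
  have hb : BddAbove {r : ℤ | ∃ k : ℤ, 1 ≤ k ∧ idx k = idx s ∧ sigmaP a1 a2 y k = r} := by
    have := bddAbove_values (f := sigmaP a1 a2 y) (A := Set.Icc 1 N) (Set.finite_Icc 1 N)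
      (K := fun k => 1 ≤ k ∧ idx k = idx s) (r := 0) (by
        intro k hk hkA
        exact hN k (by simp only [Set.mem_Icc] at hkA; omega))
    simpa only [and_assoc] using this
  obtain ⟨k, hk, hks⟩ := idx_exists_gt s N
  have hmem : (0 : ℤ) ∈ {r : ℤ | ∃ k : ℤ, 1 ≤ k ∧ idx k = idx s ∧ sigmaP a1 a2 y k = r} :=
    ⟨k, by omega, hks, hN k hk⟩
  exact ⟨Int.csSup_mem ⟨0, hmem⟩ hb, fun k h1 h2 => le_csSup hb ⟨k, h1, h2, rfl⟩, le_csSup hb hmem⟩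

lemma phiMf_spec {z : ℤ → ℤ} (hz : z.support.Finite) (s : ℤ) :
    (∃ k, k ≤ 0 ∧ idx k = idx s ∧ sigmaM a1 a2 z k = phiMf a1 a2 z (idx s)) ∧
    (∀ k, k ≤ 0 → idx k = idx s → sigmaM a1 a2 z k ≤ phiMf a1 a2 z (idx s)) ∧
    0 ≤ phiMf a1 a2 z (idx s) := by
  obtain ⟨N, h0, hN⟩ := sigmaM_eventually_zero a1 a2 hz
  have hb : BddAbove {r : ℤ | ∃ k : ℤ, k ≤ 0 ∧ idx k = idx s ∧ sigmaM a1 a2 z k = r} := by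
    have := bddAbove_values (f := sigmaM a1 a2 z) (A := Set.Icc (-N) 0) (Set.finite_Icc (-N) 0)
      (K := fun k => k ≤ 0 ∧ idx k = idx s) (r := 0) (by
        intro k hk hkA
        exact hN k (by simp only [Set.mem_Icc] at hkA; omega))
    simpa only [and_assoc] using this
  obtain ⟨k, hk, hks⟩ := idx_exists_lt s (-N)
  have hmem : (0 : ℤ) ∈ {r : ℤ | ∃ k : ℤ, k ≤ 0 ∧ idx k = idx s ∧ sigmaM a1 a2 z k = r} :=
    ⟨k, by omega, hks, hN k hk⟩
  exact ⟨Int.csSup_mem ⟨0, hmem⟩ hb, fun k h1 h2 => le_csSup hb ⟨k, h1, h2, rfl⟩, le_csSup hb hmem⟩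

lemma epsP_eq {y : ℤ → ℤ} {i r m : ℤ} (hm : 1 ≤ m) (hi : idx m = i)
    (hr : sigmaP a1 a2 y m = r) (h : ∀ k, 1 ≤ k → idx k = i → sigmaP a1 a2 y k ≤ r) :
    epsP a1 a2 y i = r := by
  refine IsGreatest.csSup_eq ⟨⟨m, hm, hi, hr⟩, ?_⟩
  rintro t ⟨k, h1, h2, rfl⟩
  exact h k h1 h2

lemma phiMf_eq {z : ℤ → ℤ} {i r m : ℤ} (hm : m ≤ 0) (hi : idx m = i)
    (hr : sigmaM a1 a2 z m = r) (h : ∀ k, k ≤ 0 → idx k = i → sigmaM a1 a2 z k ≤ r) :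
    phiMf a1 a2 z i = r := by
  refine IsGreatest.csSup_eq ⟨⟨m, hm, hi, hr⟩, ?_⟩
  rintro t ⟨k, h1, h2, rfl⟩
  exact h k h1 h2

lemma kminP_spec {y : ℤ → ℤ} (hy : y.support.Finite) (s : ℤ) :
    1 ≤ kminP a1 a2 y (idx s) ∧ idx (kminP a1 a2 y (idx s)) = idx s ∧
    sigmaP a1 a2 y (kminP a1 a2 y (idx s)) = epsP a1 a2 y (idx s) ∧
    ∀ k, 1 ≤ k → idx k = idx s → k < kminP a1 a2 y (idx s) →
      sigmaP a1 a2 y k < epsP a1 a2 y (idx s) := by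
  obtain ⟨⟨k0, hk0⟩, hle, -⟩ := epsP_spec a1 a2 hy s
  have hb : BddBelow {k : ℤ | 1 ≤ k ∧ idx k = idx s ∧
      sigmaP a1 a2 y k = epsP a1 a2 y (idx s)} := ⟨1, fun k hk => hk.1⟩
  have hmem := Int.csInf_mem ⟨k0, hk0⟩ hb
  refine ⟨hmem.1, hmem.2.1, hmem.2.2, fun k h1 h2 h3 => lt_of_le_of_ne (hle k h1 h2) fun h => ?_⟩
  exact absurd (csInf_le hb ⟨h1, h2, h⟩) (not_le.mpr h3)

lemma kmaxM_spec {z : ℤ → ℤ} (hz : z.support.Finite) (s : ℤ) :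
    kmaxM a1 a2 z (idx s) ≤ 0 ∧ idx (kmaxM a1 a2 z (idx s)) = idx s ∧
    sigmaM a1 a2 z (kmaxM a1 a2 z (idx s)) = phiMf a1 a2 z (idx s) ∧
    ∀ k, k ≤ 0 → idx k = idx s → kmaxM a1 a2 z (idx s) < k →
      sigmaM a1 a2 z k < phiMf a1 a2 z (idx s) := by
  obtain ⟨⟨k0, hk0⟩, hle, -⟩ := phiMf_spec a1 a2 hz s
  have hb : BddAbove {k : ℤ | k ≤ 0 ∧ idx k = idx s ∧
      sigmaM a1 a2 z k = phiMf a1 a2 z (idx s)} := ⟨0, fun k hk => hk.1⟩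
  have hmem := Int.csSup_mem ⟨k0, hk0⟩ hb
  refine ⟨hmem.1, hmem.2.1, hmem.2.2, fun k h1 h2 h3 => lt_of_le_of_ne (hle k h1 h2) fun h => ?_⟩
  exact absurd (le_csSup hb ⟨h1, h2, h⟩) (not_le.mpr h3)

lemma pairJK_of_idx_eq {j k : ℤ} (h : idx j = idx k) : pairJK a1 a2 j k = 2 := by
  rw [idx_eq_idx] at h
  simp [pairJK, h]

/-- `σ_k` of `f̃_i y`, together with `ε_i` and the position at which `ẽ_i` acts on it. -/
lemma fP_spec {y : ℤ → ℤ} (hy : y.support.Finite) (s : ℤ) :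
    epsP a1 a2 (fP a1 a2 (idx s) y) (idx s) = epsP a1 a2 y (idx s) + 1 ∧
    sigmaP a1 a2 (fP a1 a2 (idx s) y) (kminP a1 a2 y (idx s)) = epsP a1 a2 y (idx s) + 1 ∧
    ∀ k, 1 ≤ k → idx k = idx s → kminP a1 a2 y (idx s) < k →
      sigmaP a1 a2 (fP a1 a2 (idx s) y) k < epsP a1 a2 y (idx s) + 1 := by
  obtain ⟨h1, h2, h3, h4⟩ := kminP_spec a1 a2 hy s
  obtain ⟨-, hle, -⟩ := epsP_spec a1 a2 hy s
  set m := kminP a1 a2 y (idx s) with hm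
  have hs : ∀ k, sigmaP a1 a2 (fP a1 a2 (idx s) y) k
      = sigmaP a1 a2 y k + coeffP a1 a2 k m := by
    intro k
    rw [fP, ← hm, sigmaP_update _ _ hy]
    ring
  have hsm : sigmaP a1 a2 (fP a1 a2 (idx s) y) m = epsP a1 a2 y (idx s) + 1 := by
    rw [hs, h3]; simp [coeffP]
  have hgt : ∀ k, 1 ≤ k → idx k = idx s → m < k →
      sigmaP a1 a2 (fP a1 a2 (idx s) y) k < epsP a1 a2 y (idx s) + 1 := by
    intro k hk hks hmk
    have := hle k hk hks
    rw [hs, coeffP, if_neg (by omega), if_neg (by omega)]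
    omega
  refine ⟨epsP_eq a1 a2 h1 h2 hsm fun k hk hks => ?_, hsm, hgt⟩
  rcases lt_trichotomy k m with h | h | h
  · have := h4 k hk hks h
    rw [hs, coeffP, if_neg (by omega), if_pos h, pairJK_of_idx_eq _ _ (h2.trans hks.symm)]
    omega
  · rw [h, hsm]
  · exact (hgt k hk hks h).le

lemma phiMf_eM {z : ℤ → ℤ} (hz : z.support.Finite) (s : ℤ) :
    phiMf a1 a2 (eM a1 a2 (idx s) z) (idx s) = phiMf a1 a2 z (idx s) + 1 := by
  obtain ⟨h1, h2, h3, h4⟩ := kmaxM_spec a1 a2 hz s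
  obtain ⟨-, hle, -⟩ := phiMf_spec a1 a2 hz s
  set m := kmaxM a1 a2 z (idx s) with hm
  have hs : ∀ k, sigmaM a1 a2 (eM a1 a2 (idx s) z) k
      = sigmaM a1 a2 z k - coeffM a1 a2 k m := by
    intro k
    rw [eM, ← hm, sigmaM_update _ _ hz]
    ring
  have hsm : sigmaM a1 a2 (eM a1 a2 (idx s) z) m = phiMf a1 a2 z (idx s) + 1 := by
    rw [hs, h3]; simp [coeffM]
  refine phiMf_eq a1 a2 h1 h2 hsm fun k hk hks => ?_
  rcases lt_trichotomy k m with h | h | h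
  · have := hle k hk hks
    rw [hs, coeffM, if_neg (by omega), if_neg (by omega)]
    omega
  · rw [h, hsm]
  · have := h4 k hk hks h
    rw [hs, coeffM, if_neg (by omega), if_pos h, pairJK_of_idx_eq _ _ (h2.trans hks.symm)]
    omega


/-- The sum of the coordinates of `x` at the positions `j ≥ k` of the same colour as `k`. -/
noncomputable def tailSum (x : ℤ → ℤ) (k : ℤ) : ℤ :=
  linForm (fun j => if k ≤ j ∧ j % 2 = k % 2 then 1 else 0) x

lemma sigmaP_eq_tailSum {x : ℤ → ℤ} (hx : x.support.Finite) (k : ℤ) :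
    sigmaP a1 a2 x k
      = tailSum x k + tailSum x (k + 2) - aIdx a1 a2 k * tailSum x (k + 1) := by
  rw [sigmaP_eq_linForm _ _ hx, sub_eq_add_neg, ← neg_mul]
  unfold tailSum
  rw [← linForm_mul_coeff _ _ hx, ← linForm_add_coeff _ _ hx, ← linForm_add_coeff _ _ hx]
  congr 1
  funext j
  unfold coeffP pairJK aIdx
  split_ifs <;> omega

lemma tailSum_update {x : ℤ → ℤ} (hx : x.support.Finite) (m v k : ℤ) :
    tailSum (update x m v) k
      = tailSum x k + (if k ≤ m ∧ m % 2 = k % 2 then 1 else 0) * (v - x m) :=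
  linForm_update _ hx m v

lemma fP_support_finite {y : ℤ → ℤ} (hy : y.support.Finite) (i : ℤ) :
    (fP a1 a2 i y).support.Finite := support_update_finite hy _ _

lemma fPiter_succ (i : ℤ) (n : ℕ) (y : ℤ → ℤ) :
    fPiter a1 a2 i (n + 1) y = fP a1 a2 i (fPiter a1 a2 i n y) :=
  Function.iterate_succ_apply' _ _ _

lemma eMiter_succ (i : ℤ) (n : ℕ) (z : ℤ → ℤ) :
    eMiter a1 a2 i (n + 1) z = eM a1 a2 i (eMiter a1 a2 i n z) :=
  Function.iterate_succ_apply' _ _ _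

lemma fPiter_support_finite {y : ℤ → ℤ} (hy : y.support.Finite) (i : ℤ) (n : ℕ) :
    (fPiter a1 a2 i n y).support.Finite := by
  induction n with
  | zero => exact hy
  | succ n ih => rw [fPiter_succ]; exact fP_support_finite a1 a2 ih i

lemma eMiter_support_finite {z : ℤ → ℤ} (hz : z.support.Finite) (i : ℤ) (n : ℕ) :
    (eMiter a1 a2 i n z).support.Finite := by
  induction n with
  | zero => exact hz
  | succ n ih => rw [eMiter_succ]; exact support_update_finite ih _ _

lemma epsP_fPiter {y : ℤ → ℤ} (hy : y.support.Finite) (s : ℤ) (n : ℕ) :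
    epsP a1 a2 (fPiter a1 a2 (idx s) n y) (idx s) = epsP a1 a2 y (idx s) + n := by
  induction n with
  | zero => simp [fPiter]
  | succ n ih =>
    rw [fPiter_succ, (fP_spec a1 a2 (fPiter_support_finite a1 a2 hy _ n) s).1, ih]
    push_cast
    ring

/-- Induction over the positions `k ≥ 1` of a fixed colour. -/
lemma colour_induction {s : ℤ} {p : ℤ → Prop} (h1 : ∀ k, 1 ≤ k → k ≤ 2 → k % 2 = s % 2 → p k)
    (h2 : ∀ k, 1 ≤ k → k % 2 = s % 2 → p k → p (k + 2)) :
    ∀ k, 1 ≤ k → k % 2 = s % 2 → p k := by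
  have key : ∀ n : ℕ, ∀ k : ℤ, k ≤ n → 1 ≤ k → k % 2 = s % 2 → p k := by
    intro n
    induction n with
    | zero => intro k h h'; omega
    | succ n ih =>
      intro k hk h hs
      by_cases hk2 : k ≤ 2
      · exact h1 k h hk2 hs
      · have := h2 (k - 2) (by omega) (by omega) (ih (k - 2) (by push_cast at hk; omega)
          (by omega) (by omega))
        rwa [sub_add_cancel] at this
  intro k
  exact key k.toNat k (Int.self_le_toNat k)

/-- The effect of `f̃_i^n` on the tail sums of an element with `ε_i = 0`. -/
lemma tailSum_fPiter {u : ℤ → ℤ} (hu : u.support.Finite) {s : ℤ}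
    (h0 : epsP a1 a2 u (idx s) = 0) (n : ℕ) :
    (∀ k, k % 2 ≠ s % 2 → tailSum (fPiter a1 a2 (idx s) n u) k = tailSum u k) ∧
    (∀ k, 1 ≤ k → k ≤ 2 → k % 2 = s % 2 →
      tailSum (fPiter a1 a2 (idx s) n u) k = tailSum u k + n) ∧
    (∀ k, 1 ≤ k → k % 2 = s % 2 → tailSum u k ≤ tailSum (fPiter a1 a2 (idx s) n u) k) ∧
    (∀ k, 1 ≤ k → k % 2 = s % 2 →
      tailSum (fPiter a1 a2 (idx s) n u) (k + 2) - tailSum u (k + 2)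
        = min (tailSum (fPiter a1 a2 (idx s) n u) k - tailSum u k) (-sigmaP a1 a2 u k)) := by
  induction n with
  | zero =>
    refine ⟨fun _ _ => rfl, fun k _ _ _ => by simp [fPiter], fun _ _ _ => le_rfl, ?_⟩
    intro k hk hks
    have := (epsP_spec a1 a2 hu s).2.1 k hk (idx_eq_idx.mpr hks)
    simp only [fPiter, Function.iterate_zero, id_eq, sub_self]
    omega
  | succ n ih =>
    obtain ⟨ih1, ih2, ih3, ih4⟩ := ih
    have hv := fPiter_support_finite a1 a2 hu (idx s) n
    have heps := epsP_fPiter a1 a2 hu s n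
    obtain ⟨hm1, hm2, hm3, hm4⟩ := kminP_spec a1 a2 hv s
    rw [fPiter_succ]
    set v := fPiter a1 a2 (idx s) n u with hvdef
    set m := kminP a1 a2 v (idx s) with hmdef
    rw [heps, h0, zero_add] at hm3 hm4
    rw [idx_eq_idx] at hm2
    have hT : ∀ k, tailSum (fP a1 a2 (idx s) v) k
        = tailSum v k + if k ≤ m ∧ m % 2 = k % 2 then 1 else 0 := by
      intro k
      rw [fP, ← hmdef, tailSum_update hv]
      ring
    have hsig : ∀ k, 1 ≤ k → k % 2 = s % 2 → sigmaP a1 a2 v k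
        = sigmaP a1 a2 u k + (tailSum v k - tailSum u k)
          + (tailSum v (k + 2) - tailSum u (k + 2)) := by
      intro k hk hks
      rw [sigmaP_eq_tailSum _ _ hv, sigmaP_eq_tailSum _ _ hu, ih1 (k + 1) (by omega)]
      ring
    have hD : ∀ k, 1 ≤ k → k % 2 = s % 2 → k ≤ m → tailSum v k - tailSum u k = n := by
      refine colour_induction (s := s) ?_ ?_
      · intro k hk hk2 hks _
        rw [ih2 k hk hk2 hks]; ring
      · intro k hk hks hp hkm
        have e1 := hp (by omega)
        have e2 := hm4 k hk (idx_eq_idx.mpr hks) (by omega)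
        have e3 := ih4 k hk hks
        rw [hsig k hk hks] at e2
        omega
    refine ⟨?_, ?_, ?_, ?_⟩
    · intro k hks
      rw [hT, ih1 k hks, if_neg (by omega), add_zero]
    · intro k hk hk2 hks
      rw [hT, ih2 k hk hk2 hks, if_pos (by omega)]
      push_cast
      ring
    · intro k hk hks
      have := ih3 k hk hks
      rw [hT]
      split_ifs <;> omega
    · intro k hk hks
      have e3 := ih4 k hk hks
      rw [hT, hT]
      rcases lt_trichotomy k m with h | h | h
      · have e1 := hD k hk hks h.le
        have e2 := hm4 k hk (idx_eq_idx.mpr hks) h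
        rw [hsig k hk hks] at e2
        rw [if_pos (by omega), if_pos (by omega)]
        omega
      · have e1 := hD k hk hks h.le
        rw [← h, hsig k hk hks] at hm3
        rw [if_neg (by omega), if_pos (by omega)]
        omega
      · rw [if_neg (by omega), if_neg (by omega)]
        omega

lemma combine_update_pos (y z : ℤ → ℤ) {m : ℤ} (hm : 1 ≤ m) (v : ℤ) :
    combine (update y m v) z = update (combine y z) m v := by
  funext k
  by_cases hk : k = m
  · subst hk; simp [combine, hm]
  · simp [combine, hk]

lemma combine_update_neg (y z : ℤ → ℤ) {m : ℤ} (hm : m ≤ 0) (v : ℤ) :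
    combine y (update z m v) = update (combine y z) m v := by
  funext k
  by_cases hk : k = m
  · subst hk; simp [combine, show ¬ 1 ≤ k by omega]
  · simp [combine, hk]

lemma combine_support_finite {y z : ℤ → ℤ} (hy : y.support.Finite) (hz : z.support.Finite) :
    (combine y z).support.Finite := by
  refine (hy.union hz).subset fun k hk => ?_
  simp only [combine, mem_support] at hk
  by_cases h : 1 ≤ k <;> simp_all

lemma sigmaP_combine (y z : ℤ → ℤ) {k : ℤ} (hk : 1 ≤ k) :
    sigmaP a1 a2 (combine y z) k = sigmaP a1 a2 y k := by
  unfold sigmaP combine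
  rw [if_pos hk]
  congr 1
  refine finsum_congr fun j => ?_
  split_ifs <;> first | rfl | omega

lemma sigmaM_combine (y z : ℤ → ℤ) {k : ℤ} (hk : k ≤ 0) :
    sigmaM a1 a2 (combine y z) k = sigmaM a1 a2 z k := by
  unfold sigmaM combine
  rw [if_neg (by omega)]
  congr 1
  refine finsum_congr fun j => ?_
  split_ifs <;> first | rfl | omega

lemma sigmaZ_combine_pos (μ : ℤ × ℤ) (y z : ℤ → ℤ) {k : ℤ} (hk : 1 ≤ k) :
    sigmaZ a1 a2 μ (combine y z) k = sigmaP a1 a2 y k := by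
  rw [sigmaZ, if_pos hk, sigmaP_combine _ _ _ _ hk]

lemma sigmaZ_combine_neg (μ : ℤ × ℤ) (y z : ℤ → ℤ) {k : ℤ} (hk : k ≤ 0) :
    sigmaZ a1 a2 μ (combine y z) k
      = sigmaM a1 a2 z k - pairW (wtZ a1 a2 μ (combine y z)) (idx k) := by
  rw [sigmaZ, if_neg (by omega), sigmaM_combine _ _ _ _ hk]

/-- The tensor product rule for `ε_i`. -/
lemma epsZ_combine (μ : ℤ × ℤ) {y z : ℤ → ℤ} (hy : y.support.Finite) (hz : z.support.Finite)
    (s : ℤ) :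
    epsZ a1 a2 μ (combine y z) (idx s) = max (epsP a1 a2 y (idx s))
      (phiMf a1 a2 z (idx s) - pairW (wtZ a1 a2 μ (combine y z)) (idx s)) := by
  obtain ⟨⟨k, hk1, hk2, hk3⟩, hP, -⟩ := epsP_spec a1 a2 hy s
  obtain ⟨⟨l, hl1, hl2, hl3⟩, hM, -⟩ := phiMf_spec a1 a2 hz s
  refine IsGreatest.csSup_eq ⟨?_, ?_⟩
  · rcases le_total (epsP a1 a2 y (idx s))
      (phiMf a1 a2 z (idx s) - pairW (wtZ a1 a2 μ (combine y z)) (idx s)) with h | h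
    · rw [max_eq_right h]
      exact ⟨l, hl2, by rw [sigmaZ_combine_neg _ _ _ _ _ hl1, hl3, hl2]⟩
    · rw [max_eq_left h]
      exact ⟨k, hk2, by rw [sigmaZ_combine_pos _ _ _ _ _ hk1, hk3]⟩
  · rintro r ⟨j, hj, rfl⟩
    by_cases hj1 : 1 ≤ j
    · rw [sigmaZ_combine_pos _ _ _ _ _ hj1]
      exact le_max_of_le_left (hP j hj1 hj)
    · rw [sigmaZ_combine_neg _ _ _ _ _ (by omega), hj]
      have := hM j (by omega) hj
      exact le_max_of_le_right (by omega)

lemma kmaxZ_eq {μ : ℤ × ℤ} {b : ℤ → ℤ} {i m : ℤ} (hm : idx m = i)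
    (h : sigmaZ a1 a2 μ b m = epsZ a1 a2 μ b i)
    (hgt : ∀ k, idx k = i → m < k → sigmaZ a1 a2 μ b k < epsZ a1 a2 μ b i) :
    kmaxZ a1 a2 μ b i = m := by
  refine IsGreatest.csSup_eq ⟨⟨hm, h⟩, ?_⟩
  rintro k ⟨hk, hk'⟩
  by_contra hlt
  exact absurd hk' (hgt k hk (not_le.mp hlt)).ne

/-- `ẽ_i` acts on the positive factor when `ε_i` of it dominates. -/
lemma eZ_combine_fP (μ : ℤ × ℤ) {y z : ℤ → ℤ} (hy : y.support.Finite) (hz : z.support.Finite)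
    (s : ℤ) (h : phiMf a1 a2 z (idx s)
        - pairW (wtZ a1 a2 μ (combine (fP a1 a2 (idx s) y) z)) (idx s)
      ≤ epsP a1 a2 y (idx s) + 1) :
    eZ a1 a2 μ (idx s) (combine (fP a1 a2 (idx s) y) z) = some (combine y z) := by
  obtain ⟨hm1, hm2, -, -⟩ := kminP_spec a1 a2 hy s
  obtain ⟨hf1, hf2, hf3⟩ := fP_spec a1 a2 hy s
  have h0 := (epsP_spec a1 a2 hy s).2.2
  have heps := epsZ_combine a1 a2 μ (fP_support_finite a1 a2 hy (idx s)) hz s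
  rw [hf1, max_eq_left h] at heps
  have hk : kmaxZ a1 a2 μ (combine (fP a1 a2 (idx s) y) z) (idx s) = kminP a1 a2 y (idx s) := by
    refine kmaxZ_eq a1 a2 hm2 ?_ ?_
    · rw [sigmaZ_combine_pos _ _ _ _ _ hm1, hf2, heps]
    · intro k hk hlt
      rw [sigmaZ_combine_pos _ _ _ _ _ (by omega), heps]
      exact hf3 k (by omega) hk hlt
  rw [eZ, if_pos (by omega), hk, fP, combine_update_pos _ _ hm1]
  congr 1
  simp [combine, hm1]

/-- `ẽ_i` acts on the negative factor when the positive one does not dominate. -/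
lemma eZ_combine_eM (μ : ℤ × ℤ) {y z : ℤ → ℤ} (hy : y.support.Finite) (hz : z.support.Finite)
    (s : ℤ) (h : epsP a1 a2 y (idx s)
      < phiMf a1 a2 z (idx s) - pairW (wtZ a1 a2 μ (combine y z)) (idx s)) :
    eZ a1 a2 μ (idx s) (combine y z) = some (combine y (eM a1 a2 (idx s) z)) := by
  obtain ⟨hm1, hm2, hm3, hm4⟩ := kmaxM_spec a1 a2 hz s
  obtain ⟨-, hle, h0⟩ := epsP_spec a1 a2 hy s
  have heps := epsZ_combine a1 a2 μ hy hz s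
  rw [max_eq_right h.le] at heps
  have hk : kmaxZ a1 a2 μ (combine y z) (idx s) = kmaxM a1 a2 z (idx s) := by
    refine kmaxZ_eq a1 a2 hm2 ?_ ?_
    · rw [sigmaZ_combine_neg _ _ _ _ _ hm1, hm2, hm3, heps]
    · intro k hk hlt
      by_cases hk1 : 1 ≤ k
      · rw [sigmaZ_combine_pos _ _ _ _ _ hk1, heps]
        exact (hle k hk1 hk).trans_lt h
      · rw [sigmaZ_combine_neg _ _ _ _ _ (by omega), heps, hk]
        have := hm4 k (by omega) hk hlt
        omega
  rw [eZ, if_pos (by omega), hk, eM, combine_update_neg _ _ hm1]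
  simp [combine, show ¬ 1 ≤ kmaxM a1 a2 z (idx s) by omega]

lemma pairW_wtZ (μ : ℤ × ℤ) (b : ℤ → ℤ) (s : ℤ) :
    pairW (wtZ a1 a2 μ b) (idx s)
      = pairW μ (idx s) - linForm (fun j => pairJI a1 a2 j (idx s)) b := by
  have h : pairW (wtOf a1 a2 b) (idx s) = -linForm (fun j => pairJI a1 a2 j (idx s)) b := by
    unfold linForm wtOf pairW
    rcases isI_idx s with h | h
    · simp only [h, if_true]
      congr 1
      refine finsum_congr fun j => ?_
      rw [mul_comm]
      unfold alphaOf pairJI idx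
      split_ifs <;> simp_all
    · simp only [h, show ¬ ((2 : ℤ) = 1) by omega, if_false]
      congr 1
      refine finsum_congr fun j => ?_
      rw [mul_comm]
      unfold alphaOf pairJI idx
      split_ifs <;> simp_all
  rw [sub_eq_add_neg, ← h]
  unfold wtZ pairW
  split_ifs <;> simp

lemma pairJI_self {m s : ℤ} (h : idx m = idx s) : pairJI a1 a2 m (idx s) = 2 := by
  simp [pairJI, h]

/-- `ẽ_i^p` on `f̃_i^P y ⊗ t_μ ⊗ z`, where `p = ε_i` and `ε_i(y) = 0`. -/
lemma eZiterO_combine (μ : ℤ × ℤ) {y : ℤ → ℤ} (hy : y.support.Finite) {s : ℤ}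
    (h0 : epsP a1 a2 y (idx s) = 0) (p : ℕ) : ∀ (P : ℕ) {z : ℤ → ℤ}, z.support.Finite →
    epsZ a1 a2 μ (combine (fPiter a1 a2 (idx s) P y) z) (idx s) = p →
    eZiterO a1 a2 μ (idx s) p (some (combine (fPiter a1 a2 (idx s) P y) z))
      = some (combine y (eMiter a1 a2 (idx s) (p - P) z)) := by
  induction p with
  | zero =>
    intro P z hz h
    rw [epsZ_combine a1 a2 μ (fPiter_support_finite a1 a2 hy _ _) hz, epsP_fPiter a1 a2 hy, h0] at h
    have : P = 0 := by omega
    subst this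
    rfl
  | succ p ih =>
    intro P z hz h
    have hyP := fPiter_support_finite a1 a2 hy (idx s) P
    rw [epsZ_combine a1 a2 μ hyP hz, epsP_fPiter a1 a2 hy, h0] at h
    have hstep : ∀ o, eZiterO a1 a2 μ (idx s) (p + 1) (some o)
        = eZiterO a1 a2 μ (idx s) p (eZ a1 a2 μ (idx s) o) :=
      fun o => Function.iterate_succ_apply _ _ _
    rw [hstep]
    by_cases hcase : phiMf a1 a2 z (idx s)
        - pairW (wtZ a1 a2 μ (combine (fPiter a1 a2 (idx s) P y) z)) (idx s) ≤ P
    · obtain ⟨Q, rfl⟩ : ∃ Q, P = Q + 1 := ⟨P - 1, by omega⟩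
      have hyQ := fPiter_support_finite a1 a2 hy (idx s) Q
      obtain ⟨hm1, hm2, -, -⟩ := kminP_spec a1 a2 hyQ s
      have hw : pairW (wtZ a1 a2 μ (combine (fPiter a1 a2 (idx s) (Q + 1) y) z)) (idx s)
          = pairW (wtZ a1 a2 μ (combine (fPiter a1 a2 (idx s) Q y) z)) (idx s) - 2 := by
        rw [pairW_wtZ, pairW_wtZ, fPiter_succ, fP, combine_update_pos _ _ hm1,
          linForm_update _ (combine_support_finite hyQ hz), pairJI_self _ _ hm2]
        simp [combine, hm1]
        ring
      rw [fPiter_succ, eZ_combine_fP a1 a2 μ hyQ hz s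
        (by rw [← fPiter_succ, epsP_fPiter a1 a2 hy, h0]; omega), ih Q hz]
      · rw [Nat.add_sub_add_right]
      · rw [epsZ_combine a1 a2 μ hyQ hz, epsP_fPiter a1 a2 hy, h0]
        omega
    · obtain ⟨hm1, hm2, -, -⟩ := kmaxM_spec a1 a2 hz s
      have hw : pairW (wtZ a1 a2 μ (combine (fPiter a1 a2 (idx s) P y) (eM a1 a2 (idx s) z)))
            (idx s)
          = pairW (wtZ a1 a2 μ (combine (fPiter a1 a2 (idx s) P y) z)) (idx s) + 2 := by
        rw [pairW_wtZ, pairW_wtZ, eM, combine_update_neg _ _ hm1,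
          linForm_update _ (combine_support_finite hyP hz), pairJI_self _ _ hm2]
        simp [combine, show ¬ 1 ≤ kmaxM a1 a2 z (idx s) by omega]
        ring
      have hez : (eM a1 a2 (idx s) z).support.Finite := support_update_finite hz _ _
      rw [eZ_combine_eM a1 a2 μ hyP hz s (by rw [epsP_fPiter a1 a2 hy, h0]; omega), ih P hez]
      · have : p + 1 - P = (p - P) + 1 := by omega
        rw [this, eMiter, eMiter, Function.iterate_succ_apply]
      · rw [epsZ_combine a1 a2 μ hyP hez, epsP_fPiter a1 a2 hy, h0, hw, phiMf_eM a1 a2 hz]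
        omega

lemma eP_fP {y : ℤ → ℤ} (hy : y.support.Finite) (s : ℤ) :
    eP a1 a2 (idx s) (fP a1 a2 (idx s) y) = some y := by
  obtain ⟨hm1, hm2, -, -⟩ := kminP_spec a1 a2 hy s
  obtain ⟨hf1, hf2, hf3⟩ := fP_spec a1 a2 hy s
  have h0 := (epsP_spec a1 a2 hy s).2.2
  have hk : kmaxP a1 a2 (fP a1 a2 (idx s) y) (idx s) = kminP a1 a2 y (idx s) := by
    refine IsGreatest.csSup_eq ⟨⟨hm1, hm2, by rw [hf2, hf1]⟩, ?_⟩
    rintro k ⟨hk1, hk2, hk3⟩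
    by_contra hlt
    rw [hf1] at hk3
    exact absurd hk3 (hf3 k hk1 hk2 (not_le.mp hlt)).ne
  rw [eP, if_pos (by omega), hk, fP]
  simp

lemma ePiterO_fPiter {y : ℤ → ℤ} (hy : y.support.Finite) (s : ℤ) (n : ℕ) :
    ePiterO a1 a2 (idx s) n (some (fPiter a1 a2 (idx s) n y)) = some y := by
  induction n with
  | zero => rfl
  | succ n ih =>
    rw [fPiter_succ, ePiterO, Function.iterate_succ_apply, Option.bind_some,
      eP_fP a1 a2 (fPiter_support_finite a1 a2 hy _ n)]
    exact ih

lemma fPiter_eq_zero_of_nonpos {y : ℤ → ℤ} (hy : y.support.Finite) (h : ∀ k, k ≤ 0 → y k = 0)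
    (s : ℤ) (n : ℕ) : ∀ k, k ≤ 0 → fPiter a1 a2 (idx s) n y k = 0 := by
  induction n with
  | zero => exact h
  | succ n ih =>
    intro k hk
    have hm := (kminP_spec a1 a2 (fPiter_support_finite a1 a2 hy (idx s) n) s).1
    rw [fPiter_succ, fP, update_of_ne (by omega), ih k hk]

lemma eMiter_eq_zero_of_pos {z : ℤ → ℤ} (hz : z.support.Finite) (h : ∀ k, 1 ≤ k → z k = 0)
    (s : ℤ) (n : ℕ) : ∀ k, 1 ≤ k → eMiter a1 a2 (idx s) n z k = 0 := by
  induction n with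
  | zero => exact h
  | succ n ih =>
    intro k hk
    have hm := (kmaxM_spec a1 a2 (eMiter_support_finite a1 a2 hz (idx s) n) s).1
    rw [eMiter_succ, eM, update_of_ne (by omega), ih k hk]

lemma linForm_fPiter {y : ℤ → ℤ} (hy : y.support.Finite) {s v : ℤ} {c : ℤ → ℤ}
    (hc : ∀ j, idx j = idx s → c j = v) (n : ℕ) :
    linForm c (fPiter a1 a2 (idx s) n y) = linForm c y + n * v := by
  induction n with
  | zero => simp [fPiter]
  | succ n ih =>
    have hf := fPiter_support_finite a1 a2 hy (idx s) n
    rw [fPiter_succ, fP, linForm_update _ hf, hc _ (kminP_spec a1 a2 hf s).2.1, ih]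
    push_cast
    ring

lemma linForm_eMiter {z : ℤ → ℤ} (hz : z.support.Finite) {s v : ℤ} {c : ℤ → ℤ}
    (hc : ∀ j, idx j = idx s → c j = v) (n : ℕ) :
    linForm c (eMiter a1 a2 (idx s) n z) = linForm c z - n * v := by
  induction n with
  | zero => simp [eMiter]
  | succ n ih =>
    have hf := eMiter_support_finite a1 a2 hz (idx s) n
    rw [eMiter_succ, eM, linForm_update _ hf, hc _ (kmaxM_spec a1 a2 hf s).2.1, ih]
    push_cast
    ring

lemma linForm_combine (c : ℤ → ℤ) {y z : ℤ → ℤ} (hy : y.support.Finite) (hz : z.support.Finite)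
    (hy0 : ∀ k, k ≤ 0 → y k = 0) (hz0 : ∀ k, 1 ≤ k → z k = 0) :
    linForm c (combine y z) = linForm c y + linForm c z := by
  classical
  have h1 : y.support ⊆ (hy.toFinset ∪ hz.toFinset : Finset ℤ) := by simp
  have h2 : z.support ⊆ (hy.toFinset ∪ hz.toFinset : Finset ℤ) := by simp
  have h3 : (combine y z).support ⊆ (hy.toFinset ∪ hz.toFinset : Finset ℤ) := by
    intro k hk
    simp only [combine, mem_support] at hk
    by_cases h : 1 ≤ k <;> simp_all
  rw [linForm_eq_sum c h1, linForm_eq_sum c h2, linForm_eq_sum c h3, ← Finset.sum_add_distrib]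
  refine Finset.sum_congr rfl fun j _ => ?_
  unfold combine
  split_ifs with h
  · rw [hz0 j h]; ring
  · rw [hy0 j (by omega)]; ring

lemma cseq_succ_succ (n : ℕ) :
    cseq a1 a2 (n + 2) = aIdx a1 a2 ((n : ℤ) + 1) * cseq a1 a2 (n + 1) - cseq a1 a2 n := by
  rw [cseq, aIdx]
  congr 2
  split_ifs <;> first | rfl | omega

lemma cseq_pos (ha1 : 1 ≤ a1) (ha : 4 < a1 * a2) (n : ℕ) :
    0 < cseq a1 a2 (n + 1) := by
  have rec4 : ∀ n, cseq a1 a2 (n + 4)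
      = (a1 * a2 - 2) * cseq a1 a2 (n + 2) - cseq a1 a2 n := by
    intro n
    have e1 := cseq_succ_succ a1 a2 n
    have e2 := cseq_succ_succ a1 a2 (n + 1)
    have e3 := cseq_succ_succ a1 a2 (n + 2)
    push_cast at e1 e2 e3
    have h13 : aIdx a1 a2 ((n : ℤ) + 2 + 1) = aIdx a1 a2 ((n : ℤ) + 1) := by
      unfold aIdx
      split_ifs <;> first | rfl | omega
    have h12 : aIdx a1 a2 ((n : ℤ) + 1) * aIdx a1 a2 ((n : ℤ) + 1 + 1) = a1 * a2 := by
      unfold aIdx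
      split_ifs <;> first | omega | ring
    rw [h13] at e3
    rw [e3, e2, ← h12]
    linear_combination (1 : ℤ) * e1
  have key : ∀ n, 0 < cseq a1 a2 (n + 1) ∧ cseq a1 a2 n ≤ cseq a1 a2 (n + 2) ∧
      0 < cseq a1 a2 (n + 2) ∧ cseq a1 a2 (n + 1) ≤ cseq a1 a2 (n + 3) := by
    intro n
    induction n with
    | zero =>
      have e3 : cseq a1 a2 3 = a2 * a1 - 1 := by simp [cseq]
      have e2 : cseq a1 a2 2 = a1 := by simp [cseq]
      have e1 : cseq a1 a2 1 = 1 := rfl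
      have e0 : cseq a1 a2 0 = 0 := rfl
      norm_num [e0, e1, e2, e3]
      exact ⟨by omega, by omega, by linarith⟩
    | succ n ih =>
      obtain ⟨h1, h2, h3, h4⟩ := ih
      refine ⟨h3, h4, lt_of_lt_of_le h1 h4, ?_⟩
      rw [show n + 1 + 3 = n + 4 by ring, show n + 1 + 1 = n + 2 by ring, rec4]
      nlinarith
  exact (key n).1

lemma ppos_succ_succ (k1 k2 : ℤ) (n : ℕ) :
    ppos a1 a2 k1 k2 (n + 2)
      = aIdx a1 a2 n * ppos a1 a2 k1 k2 (n + 1) - ppos a1 a2 k1 k2 n := by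
  rw [ppos, aIdx]
  congr 2
  split_ifs <;> first | rfl | omega

lemma ppos_pos (ha1 : 1 ≤ a1) (ha2 : 1 ≤ a2) (ha : 4 < a1 * a2)
    (k1 k2 : ℤ) (hk1 : 0 < k1) (hk2 : 0 < k2)
    (hreg : 2 ≤ a1 → 2 ≤ a2 →
      (k2 ≤ k1 ∧ k1 < (a1 - 1) * k2) ∨ (k1 < k2 ∧ k2 ≤ (a2 - 1) * k1))
    (hdeg1 : a1 = 1 → 2 * k1 ≤ k2 ∧ k2 ≤ (a2 - 2) * k1)
    (hdeg2 : a2 = 1 → 2 * k2 ≤ k1 ∧ k1 ≤ (a1 - 2) * k2) (n : ℕ) :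
    0 < ppos a1 a2 k1 k2 n := by
  have e0 : ppos a1 a2 k1 k2 0 = k2 := rfl
  have e1 : ppos a1 a2 k1 k2 1 = k1 := rfl
  have hodd : ∀ n : ℕ, aIdx a1 a2 ((2 * n + 1 : ℕ) : ℤ) = a1 := by
    intro n; unfold aIdx; rw [if_pos (by omega)]
  have heven : ∀ n : ℕ, aIdx a1 a2 ((2 * n : ℕ) : ℤ) = a2 := by
    intro n; unfold aIdx; rw [if_neg (by omega)]
  have r0 : ∀ n : ℕ, ppos a1 a2 k1 k2 (2 * n + 2)
      = a2 * ppos a1 a2 k1 k2 (2 * n + 1) - ppos a1 a2 k1 k2 (2 * n) := by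
    intro n
    rw [ppos_succ_succ, heven]
  have r1 : ∀ n : ℕ, ppos a1 a2 k1 k2 (2 * n + 3)
      = a1 * ppos a1 a2 k1 k2 (2 * n + 2) - ppos a1 a2 k1 k2 (2 * n + 1) := by
    intro n
    rw [ppos_succ_succ, hodd]
  by_cases h1 : a1 = 1
  · have key : ∀ n : ℕ, 0 < ppos a1 a2 k1 k2 (2 * n + 1) ∧
        2 * ppos a1 a2 k1 k2 (2 * n + 1) ≤ ppos a1 a2 k1 k2 (2 * n + 2) := by
      intro n
      induction n with
      | zero =>
        have := r0 0
        simp only [mul_zero, zero_add, e0, e1] at this ⊢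
        refine ⟨hk1, ?_⟩
        rw [this]
        linarith [(hdeg1 h1).2]
      | succ n ih =>
        have b1 := r1 n
        have b2 := r0 (n + 1)
        rw [show 2 * (n + 1) = 2 * n + 2 by ring] at b2 ⊢
        rw [show 2 * n + 2 + 1 = 2 * n + 3 by ring] at b2 ⊢
        rw [b2]
        generalize ppos a1 a2 k1 k2 (2 * n + 1) = A, ppos a1 a2 k1 k2 (2 * n + 2) = B,
          ppos a1 a2 k1 k2 (2 * n + 3) = C at *
        rw [h1, one_mul] at ha b1
        constructor <;> nlinarith
    rcases Nat.even_or_odd' n with ⟨m, rfl | rfl⟩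
    · rcases m with _ | m
      · simpa [e0] using hk2
      · have := key m
        rw [show 2 * (m + 1) = 2 * m + 2 by ring]
        omega
    · exact (key m).1
  by_cases h2 : a2 = 1
  · have key : ∀ n : ℕ, 0 < ppos a1 a2 k1 k2 (2 * n) ∧
        2 * ppos a1 a2 k1 k2 (2 * n) ≤ ppos a1 a2 k1 k2 (2 * n + 1) := by
      intro n
      induction n with
      | zero =>
        simp only [mul_zero, zero_add, e0, e1]
        exact ⟨hk2, (hdeg2 h2).1⟩
      | succ n ih =>
        have b1 := r1 n
        have b2 := r0 n
        rw [show 2 * (n + 1) = 2 * n + 2 by ring]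
        rw [show 2 * n + 2 + 1 = 2 * n + 3 by ring]
        rw [b1]
        generalize ppos a1 a2 k1 k2 (2 * n + 1) = A, ppos a1 a2 k1 k2 (2 * n + 2) = B,
          ppos a1 a2 k1 k2 (2 * n) = C at *
        rw [h2, mul_one] at ha
        rw [h2, one_mul] at b2
        constructor <;> nlinarith
    rcases Nat.even_or_odd' n with ⟨m, rfl | rfl⟩
    · exact (key m).1
    · have := key m
      omega
  · have g1 : 2 ≤ a1 := by omega
    have g2 : 2 ≤ a2 := by omega
    have hge : ∀ m, 2 ≤ aIdx a1 a2 m := by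
      intro m; unfold aIdx; split_ifs <;> assumption
    have key : ∀ n : ℕ, 0 < ppos a1 a2 k1 k2 (n + 1) ∧
        ppos a1 a2 k1 k2 (n + 1) ≤ ppos a1 a2 k1 k2 (n + 2) := by
      intro n
      induction n with
      | zero =>
        have := r0 0
        simp only [mul_zero, zero_add, e0, e1] at this ⊢
        refine ⟨hk1, ?_⟩
        rw [this]
        rcases hreg g1 g2 with h | h <;> nlinarith
      | succ n ih =>
        have b := ppos_succ_succ a1 a2 k1 k2 (n + 1)
        have hb := hge ((n + 1 : ℕ) : ℤ)
        rw [show n + 1 + 2 = n + 3 by ring, show n + 1 + 1 = n + 2 by ring] at *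
        constructor
        · omega
        · rw [b]; nlinarith
    rcases n with _ | n
    · simpa [e0] using hk2
    · exact (key n).1

lemma aIdx_congr {j k : ℤ} (h : j % 2 = k % 2) : aIdx a1 a2 j = aIdx a1 a2 k := by
  rw [aIdx, aIdx, h]

/-- If `u = f̃_{i_{s+1}}^m v` and `v = f̃_{i_s}^n w`, where `ε_{i_{s+1}}(v) = ε_{i_s}(w) = 0`, then
`-σ_k(u)` is bounded below in terms of the changes of the tail sums. -/
lemma sub_le_neg_sigmaP {u v w : ℤ → ℤ} (hv : v.support.Finite) (hw : w.support.Finite)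
    {s : ℤ} {m n : ℕ} (huv : u = fPiter a1 a2 (idx (s + 1)) m v)
    (hvw : v = fPiter a1 a2 (idx s) n w)
    (hv0 : epsP a1 a2 v (idx (s + 1)) = 0) (hw0 : epsP a1 a2 w (idx s) = 0)
    {k : ℤ} (hk : 1 ≤ k) (hks : k % 2 = s % 2) :
    aIdx a1 a2 s * (tailSum u (k + 1) - tailSum v (k + 1)) - (tailSum v k - tailSum w k)
      ≤ -sigmaP a1 a2 u k := by
  have hu : u.support.Finite := huv ▸ fPiter_support_finite a1 a2 hv _ _
  obtain ⟨u1, -, -, -⟩ := tailSum_fPiter a1 a2 hv hv0 m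
  obtain ⟨v1, -, -, v4⟩ := tailSum_fPiter a1 a2 hw hw0 n
  rw [← huv] at u1
  rw [← hvw] at v1 v4
  have e1 := u1 k (by omega)
  have e2 := u1 (k + 2) (by omega)
  have e3 := v1 (k + 1) (by omega)
  have e4 := (v4 k hk hks).trans_le (min_le_right _ _)
  rw [sigmaP_eq_tailSum a1 a2 hu, e1, e2, aIdx_congr a1 a2 hks]
  rw [sigmaP_eq_tailSum a1 a2 hw, aIdx_congr a1 a2 hks] at e4
  rw [e3]
  linarith

lemma epsP_eq_zero_of_sigmaP_nonpos {y : ℤ → ℤ} (hy : y.support.Finite) {s : ℤ}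
    (h : ∀ k, 1 ≤ k → k % 2 = s % 2 → sigmaP a1 a2 y k ≤ 0) : epsP a1 a2 y (idx s) = 0 := by
  obtain ⟨⟨k, hk1, hk2, hk3⟩, -, h0⟩ := epsP_spec a1 a2 hy s
  exact le_antisymm (hk3 ▸ h k hk1 (idx_eq_idx.mp hk2)) h0

lemma tailSum_zero (k : ℤ) : tailSum (fun _ => 0) k = 0 := by
  simp [tailSum, linForm]

lemma epsP_zero (s : ℤ) : epsP a1 a2 (fun _ => 0) (idx s) = 0 := by
  have hf : (fun _ : ℤ => (0 : ℤ)).support.Finite := by simp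
  refine epsP_eq_zero_of_sigmaP_nonpos a1 a2 hf fun k _ _ => ?_
  simp [sigmaP_eq_tailSum a1 a2 hf, tailSum_zero]

/-- Along the chain `Y n = f̃_{i_{n+1}}^{ξ n} (Y (n+1))` whose exponents satisfy the cone
inequalities, `ε_{i_{n+1}} (Y (n+1)) = 0`. -/
lemma epsP_chain_eq_zero (ha1 : 1 ≤ a1) (ha : 4 < a1 * a2)
    {Y : ℕ → ℤ → ℤ} {ξ : ℕ → ℕ} {N : ℕ} (hfin : ∀ n, (Y n).support.Finite)
    (hY : ∀ n, Y n = fPiter a1 a2 (idx ((n : ℤ) + 1)) (ξ n) (Y (n + 1)))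
    (hN : ∀ n, N ≤ n → Y n = fun _ => 0)
    (hξ : ∀ n, cseq a1 a2 n * ξ (n + 1) ≤ cseq a1 a2 (n + 1) * ξ n) (n : ℕ) :
    epsP a1 a2 (Y (n + 1)) (idx ((n : ℤ) + 1)) = 0 := by
  have hc0 : ∀ n, 0 ≤ cseq a1 a2 n := by
    rintro (_ | n)
    · exact le_rfl
    · exact (cseq_pos a1 a2 ha1 ha n).le
  have key : ∀ d n, N ≤ n + d → epsP a1 a2 (Y (n + 1)) (idx ((n : ℤ) + 1)) = 0 ∧
      ∀ k : ℤ, 1 ≤ k → (k + 1) % 2 = ((n : ℤ) + 1) % 2 →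
        cseq a1 a2 n * (tailSum (Y (n + 1)) k - tailSum (Y (n + 2)) k) ≤
        cseq a1 a2 (n + 1) * (tailSum (Y n) (k + 1) - tailSum (Y (n + 1)) (k + 1)) := by
    intro d
    induction d using Nat.strong_induction_on with
    | _ d ih =>
    intro n hn
    by_cases hNn : N ≤ n
    · rw [hN n hNn, hN (n + 1) (by omega), hN (n + 2) (by omega)]
      exact ⟨epsP_zero a1 a2 _, fun k _ _ => by simp⟩
    obtain ⟨E1, C1⟩ := ih (d - 1) (by omega) (n + 1) (by omega)
    have E2 : epsP a1 a2 (Y (n + 3)) (idx ((n : ℤ) + 1)) = 0 := by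
      have := (ih (d - 2) (by omega) (n + 2) (by omega)).1
      rw [idx_eq_idx.mpr (show (((n + 2 : ℕ) : ℤ) + 1) % 2 = ((n : ℤ) + 1) % 2 by
        push_cast; omega)] at this
      exact this
    have hY1 := hY (n + 1)
    have hY2 := hY (n + 2)
    rw [idx_eq_idx.mpr (show (((n + 2 : ℕ) : ℤ) + 1) % 2 = ((n : ℤ) + 1) % 2 by
        push_cast; omega)] at hY2
    push_cast at hY1 E1 C1
    have hs := @sub_le_neg_sigmaP a1 a2 _ _ _ (hfin (n + 2)) (hfin (n + 3)) _ _ _ hY1 hY2 E1 E2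
    have hcrec := cseq_succ_succ a1 a2 n
    have hcp := cseq_pos a1 a2 ha1 ha n
    have hcn := hc0 n
    have hb : ∀ k : ℤ, 1 ≤ k → k % 2 = ((n : ℤ) + 1) % 2 →
        cseq a1 a2 n * (tailSum (Y (n + 1)) (k + 1) - tailSum (Y (n + 2)) (k + 1)) ≤
        cseq a1 a2 (n + 1) * -sigmaP a1 a2 (Y (n + 1)) k := by
      intro k hk hks
      have h1 := C1 k hk (by omega)
      have h2 := mul_le_mul_of_nonneg_left (hs hk hks) hcp.le
      rw [show n + 1 + 1 = n + 2 from rfl, show n + 1 + 2 = n + 3 from rfl, hcrec] at h1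
      linarith
    obtain ⟨-, u2, u3, u4⟩ := tailSum_fPiter a1 a2 (hfin (n + 2)) E1 (ξ (n + 1))
    rw [← hY1] at u2 u3 u4
    have E0 : epsP a1 a2 (Y (n + 1)) (idx ((n : ℤ) + 1)) = 0 := by
      refine epsP_eq_zero_of_sigmaP_nonpos a1 a2 (hfin _) fun k hk hks => ?_
      have h1 := hb k hk hks
      have h2 := mul_nonneg hcn (sub_nonneg.mpr (u3 (k + 1) (by omega) (by omega)))
      have h3 := nonneg_of_mul_nonneg_right (h2.trans h1) hcp
      linarith
    refine ⟨E0, ?_⟩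
    obtain ⟨-, v2, v3, v4⟩ := tailSum_fPiter a1 a2 (hfin (n + 1)) E0 (ξ n)
    rw [← hY n] at v2 v3 v4
    have hξn := hξ n
    have hstep : ∀ k : ℤ, 1 ≤ k → k % 2 = ((n : ℤ) + 1) % 2 →
        cseq a1 a2 n * (tailSum (Y (n + 1)) (k + 1) - tailSum (Y (n + 2)) (k + 1)) ≤
        cseq a1 a2 (n + 1) * (tailSum (Y n) k - tailSum (Y (n + 1)) k) →
        cseq a1 a2 n * (tailSum (Y (n + 1)) (k + 1) - tailSum (Y (n + 2)) (k + 1)) ≤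
        cseq a1 a2 (n + 1) * (tailSum (Y n) (k + 2) - tailSum (Y (n + 1)) (k + 2)) := by
      intro k hk hks h
      rw [v4 k hk hks]
      rcases min_choice (tailSum (Y n) k - tailSum (Y (n + 1)) k)
        (-sigmaP a1 a2 (Y (n + 1)) k) with h' | h' <;> rw [h']
      · exact h
      · exact hb k hk hks
    have hall := colour_induction (s := (n : ℤ)) (p := fun k =>
      cseq a1 a2 n * (tailSum (Y (n + 1)) k - tailSum (Y (n + 2)) k) ≤
        cseq a1 a2 (n + 1) * (tailSum (Y n) (k + 1) - tailSum (Y (n + 1)) (k + 1))) ?_ ?_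
    · exact fun k hk hks => hall k hk (by omega)
    · intro k hk1 hk2 hks
      have hu := u2 k hk1 hk2 (by omega)
      rcases (show k = 1 ∨ k = 2 by omega) with rfl | rfl
      · have hv := v2 2 (by norm_num) le_rfl (by omega)
        norm_num [hu, hv]
        exact hξn
      · have hv := v2 1 le_rfl (by norm_num) (by omega)
        refine hstep 1 le_rfl (by omega) ?_
        norm_num [hu, hv]
        exact hξn
    · intro k hk hks h
      have h1 := (u4 k hk (by omega)).trans_le (min_le_left _ _)
      have h2 := hstep (k + 1) (by omega) (by omega)
      rw [show k + 1 + 1 = k + 2 by ring] at h2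
      rw [show k + 2 + 1 = k + 1 + 2 by ring]
      exact h2 ((mul_le_mul_of_nonneg_left h1 hcn).trans h)
  exact (key N n (by omega)).1

lemma starPChain_unfold (x : ℤ → ℤ) (N : ℕ) : ∀ z : ℤ → ℤ, ∃ Y : ℕ → ℤ → ℤ,
    Y 0 = starPChain a1 a2 x N z ∧ (∀ n, N ≤ n → Y n = z) ∧
    ∀ n, n < N → Y n = fPiter a1 a2 (idx ((n : ℤ) + 1)) (x ((n : ℤ) + 1)).toNat (Y (n + 1)) := by
  induction N with
  | zero => exact fun z => ⟨fun _ => z, rfl, fun _ _ => rfl, fun n hn => by omega⟩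
  | succ N ih =>
    intro z
    obtain ⟨Y, h0, h1, h2⟩ :=
      ih (fPiter a1 a2 (idx ((N : ℤ) + 1)) (x ((N : ℤ) + 1)).toNat z)
    refine ⟨fun n => if n ≤ N then Y n else z, h0, fun n hn => if_neg (by omega), ?_⟩
    intro n hn
    rcases Nat.lt_succ_iff_lt_or_eq.mp hn with h | rfl
    · simp only [if_pos h.le, if_pos (show n + 1 ≤ N from h)]
      exact h2 n h
    · simp [h1 n le_rfl]

/-- The chain of partial products in the definition of `starP`. -/
lemma exists_starP_chain {x : ℤ → ℤ} (hx : ZPlusMem x) : ∃ (Y : ℕ → ℤ → ℤ) (N : ℕ),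
    (∀ k : ℤ, (N : ℤ) < k → x k = 0) ∧ Y 0 = starP a1 a2 x ∧
    (∀ n, N ≤ n → Y n = fun _ => 0) ∧
    (∀ n, Y n = fPiter a1 a2 (idx ((n : ℤ) + 1)) (x ((n : ℤ) + 1)).toNat (Y (n + 1))) ∧
    ∀ n, (Y n).support.Finite ∧ ∀ k, k ≤ 0 → Y n k = 0 := by
  have hN : ∀ k : ℤ, (suppBoundP x : ℤ) < k → x k = 0 := Nat.sInf_mem hx.2.2
  obtain ⟨Y, h0, h1, h2⟩ := starPChain_unfold a1 a2 x (suppBoundP x) fun _ => 0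
  have hrec : ∀ n, Y n
      = fPiter a1 a2 (idx ((n : ℤ) + 1)) (x ((n : ℤ) + 1)).toNat (Y (n + 1)) := by
    intro n
    by_cases h : n < suppBoundP x
    · exact h2 n h
    · rw [h1 n (by omega), h1 (n + 1) (by omega), hN _ (by omega)]
      rfl
  refine ⟨Y, suppBoundP x, hN, h0, h1, hrec, ?_⟩
  have key : ∀ d n, suppBoundP x ≤ n + d →
      (Y n).support.Finite ∧ ∀ k, k ≤ 0 → Y n k = 0 := by
    intro d
    induction d with
    | zero =>
      intro n hn
      rw [h1 n hn]
      simp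
    | succ d ih =>
      intro n hn
      obtain ⟨g1, g2⟩ := ih (n + 1) (by omega)
      rw [hrec n]
      exact ⟨fPiter_support_finite a1 a2 g1 _ _, fPiter_eq_zero_of_nonpos a1 a2 g1 g2 _ _⟩
  exact fun n => key (suppBoundP x) n (by omega)

lemma linForm_starP {x : ℤ → ℤ} (hx : ZPlusMem x) {c : ℤ → ℤ}
    (hc : ∀ j k, idx j = idx k → c j = c k) :
    linForm c (starP a1 a2 x) = linForm c x := by
  obtain ⟨Y, N, hN, h0, h1, hY, hf⟩ := exists_starP_chain a1 a2 hx
  have hsum : ∀ n : ℕ, linForm c (Y 0)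
      = linForm c (Y n) + ∑ m ∈ Finset.range n, c ((m : ℤ) + 1) * x ((m : ℤ) + 1) := by
    intro n
    induction n with
    | zero => simp
    | succ n ih =>
      rw [ih, Finset.sum_range_succ, hY n,
        linForm_fPiter a1 a2 (hf (n + 1)).1 (fun j hj => hc j _ hj),
        Int.toNat_of_nonneg (hx.2.1 _)]
      ring
  have hs : x.support ⊆ ((Finset.range N).map
      ⟨fun m : ℕ => (m : ℤ) + 1, fun a b h => by simpa using h⟩ : Finset ℤ) := by
    intro k hk
    have h1 : 1 ≤ k := by
      by_contra h
      exact hk (hx.1 k (by omega))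
    have h2 : k ≤ N := by
      by_contra h
      exact hk (hN k (by omega))
    simp only [Finset.coe_map, Set.mem_image, Finset.coe_range, Set.mem_Iio]
    exact ⟨(k - 1).toNat, by omega, show ((k - 1).toNat : ℤ) + 1 = k by omega⟩
  rw [← h0, hsum N, h1 N le_rfl, linForm_eq_sum c hs, Finset.sum_map]
  simp only [linForm, mul_zero, finsum_zero, zero_add]
  rfl

lemma starMChain_zero (n : ℕ) :
    starMChain a1 a2 (fun _ => 0) n (fun _ => 0) = fun _ => 0 := by
  induction n with
  | zero => rfl
  | succ n ih => simpa [starMChain, eMiter] using ih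

lemma posPart_of_ZPlusMem {x : ℤ → ℤ} (hx : ZPlusMem x) : posPart x = x := by
  funext k
  unfold posPart
  split_ifs with h
  · rfl
  · exact (hx.1 k (by omega)).symm

lemma negPart_of_ZPlusMem {x : ℤ → ℤ} (hx : ZPlusMem x) : negPart x = fun _ => 0 := by
  funext k
  unfold negPart
  split_ifs with h
  · exact hx.1 k h
  · rfl

lemma xstarFun_of_ZPlusMem {x : ℤ → ℤ} (hx : ZPlusMem x) :
    xstarFun a1 a2 x = combine (starP a1 a2 x) fun _ => 0 := by
  rw [xstarFun, posPart_of_ZPlusMem hx, negPart_of_ZPlusMem hx, starM, starMChain_zero]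

/-- The weight of `x*` is `-λ`. -/
lemma pairW_wtZ_xstarFun {x : ℤ → ℤ} (hx : ZPlusMem x) (lam : ℤ × ℤ) (s : ℤ) :
    pairW (wtZ a1 a2 (mustar a1 a2 lam x) (combine (starP a1 a2 x) fun _ => 0)) (idx s)
      = -pairW lam (idx s) := by
  obtain ⟨Y, N, -, h0, -, -, hf⟩ := exists_starP_chain a1 a2 hx
  have hz : wtOf a1 a2 (fun _ => 0) = 0 := by simp [wtOf]
  have hc : ∀ j k, idx j = idx k → pairJI a1 a2 j (idx s) = pairJI a1 a2 k (idx s) := by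
    intro j k h
    simp only [pairJI, h]
  have hw := pairW_wtZ a1 a2 0 x s
  rw [wtZ, zero_add] at hw
  rw [pairW_wtZ, linForm_combine _ (h0 ▸ (hf 0).1) (by simp) (h0 ▸ (hf 0).2) (by simp),
    linForm_starP a1 a2 hx hc, mustar, posPart_of_ZPlusMem hx, negPart_of_ZPlusMem hx, hz]
  have hl : linForm (fun j => pairJI a1 a2 j (idx s)) (fun _ => 0) = 0 := by simp [linForm]
  rw [hl]
  simp only [pairW] at hw ⊢
  split_ifs at hw ⊢ <;> simp at hw ⊢ <;> linarith

/-- `S_{w_n}` as an instance of the products in the definition of `Extremal`. -/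
lemma exists_list_SwPos (μ : ℤ × ℤ) (n : ℕ) (b : Option (ℤ → ℤ)) :
    ∃ js : List ℤ, (∀ j ∈ js, IsI j) ∧ js.foldr (SiO a1 a2 μ) b = SwPos a1 a2 μ n b := by
  induction n with
  | zero => exact ⟨[], by simp, rfl⟩
  | succ n ih =>
    obtain ⟨js, h1, h2⟩ := ih
    refine ⟨idx ((n : ℤ) + 1) :: js, ?_, ?_⟩
    · intro j hj
      rcases List.mem_cons.mp hj with rfl | h
      · exact isI_idx _
      · exact h1 j h
    · rw [List.foldr_cons, h2, SwPos]

/-- Applying `f̃_{i_s}^X` backwards on `y` and `ẽ_{i_s}^Q` on `z` raises the weight by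
`(X + Q) α_{i_s}`. -/
lemma pairW_wtZ_step (μ : ℤ × ℤ) {y z : ℤ → ℤ} (hy : y.support.Finite) (hz : z.support.Finite)
    (hy0 : ∀ k, k ≤ 0 → y k = 0) (hz0 : ∀ k, 1 ≤ k → z k = 0) (s r : ℤ) (X Q : ℕ) :
    pairW (wtZ a1 a2 μ (combine y (eMiter a1 a2 (idx s) Q z))) (idx r)
      = pairW (wtZ a1 a2 μ (combine (fPiter a1 a2 (idx s) X y) z)) (idx r)
        + ((X : ℤ) + Q) * pairJI a1 a2 s (idx r) := by
  have hc : ∀ j, idx j = idx s → pairJI a1 a2 j (idx r) = pairJI a1 a2 s (idx r) := by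
    intro j h
    simp only [pairJI, h]
  rw [pairW_wtZ, pairW_wtZ,
    linForm_combine _ hy (eMiter_support_finite a1 a2 hz _ _) hy0
      (eMiter_eq_zero_of_pos a1 a2 hz hz0 _ _),
    linForm_combine _ (fPiter_support_finite a1 a2 hy _ _) hz
      (fPiter_eq_zero_of_nonpos a1 a2 hy hy0 _ _) hz0,
    linForm_fPiter a1 a2 hy hc, linForm_eMiter a1 a2 hz hc]
  ring

lemma pairJI_succ (n : ℤ) : pairJI a1 a2 (n + 1) (idx n) = -aIdx a1 a2 n := by
  have h : idx (n + 1) ≠ idx n := fun h => by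
    have := idx_eq_idx.mp h
    omega
  rw [pairJI, if_neg h, aIdx]
  unfold idx
  split_ifs <;> simp_all

/-- If `f̃_i` kills `f̃_i^X y ⊗ t_μ ⊗ z`, whose weight pairs to `-p` with `α_i^∨`, then `X ≤ p` and
`S_i` is computed componentwise. -/
lemma SiO_combine (μ : ℤ × ℤ) {y z : ℤ → ℤ} (hy : y.support.Finite) (hz : z.support.Finite)
    {s p : ℤ} (hp : 0 < p) {X : ℕ} (h0 : epsP a1 a2 y (idx s) = 0)
    (hw : pairW (wtZ a1 a2 μ (combine (fPiter a1 a2 (idx s) X y) z)) (idx s) = -p)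
    (hf : fZ a1 a2 μ (idx s) (combine (fPiter a1 a2 (idx s) X y) z) = none) :
    (X : ℤ) ≤ p ∧ SiO a1 a2 μ (idx s) (some (combine (fPiter a1 a2 (idx s) X y) z))
      = some (combine y (eMiter a1 a2 (idx s) (p - X).toNat z)) := by
  have hphi : phiZ a1 a2 μ (combine (fPiter a1 a2 (idx s) X y) z) (idx s) ≤ 0 := by
    by_contra h
    rw [fZ, if_pos (not_le.mp h)] at hf
    simp at hf
  rw [phiZ, hw] at hphi
  have he := epsZ_combine a1 a2 μ (fPiter_support_finite a1 a2 hy (idx s) X) hz s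
  rw [hw, epsP_fPiter a1 a2 hy, h0] at he
  have hM := (phiMf_spec a1 a2 hz s).2.2
  have heps : epsZ a1 a2 μ (combine (fPiter a1 a2 (idx s) X y) z) (idx s) = p.toNat := by
    omega
  refine ⟨by omega, ?_⟩
  rw [SiO, Option.bind_some, hw, if_neg (by omega), neg_neg,
    eZiterO_combine a1 a2 μ hy h0 _ _ hz heps]
  congr 3
  omega

lemma pseq_succ (k1 k2 : ℤ) (n : ℕ) :
    pseq a1 a2 k1 k2 ((n : ℤ) + 1) = ppos a1 a2 k1 k2 (n + 1) := by
  rw [pseq, if_pos (by omega)]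
  congr 1

lemma SwPos_xstar (ha1 : 1 ≤ a1) (ha : 4 < a1 * a2) {k1 k2 : ℤ}
    (hp : ∀ n, 0 < ppos a1 a2 k1 k2 n) {x : ℤ → ℤ} (hx : XPlusMem a1 a2 x) {μ : ℤ × ℤ}
    (hμ : μ = mustar a1 a2 (lamW k1 k2) x)
    (hext : Extremal a1 a2 μ (xstarFun a1 a2 x)) (n : ℕ) :
    x ((n : ℤ) + 1) ≤ pseq a1 a2 k1 k2 ((n : ℤ) + 1) ∧ ∃ y : ℤ → ℤ,
      ePposChainO a1 a2 (fun m => (x m).toNat) (n + 1) (some (starP a1 a2 x)) = some y ∧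
      SwPos a1 a2 μ (n + 1) (some (xstarFun a1 a2 x)) = some (combine y
        (eMposChain a1 a2 (fun m => (pseq a1 a2 k1 k2 m - x m).toNat) (n + 1) fun _ => 0)) := by
  obtain ⟨Y, N, -, hY0, hN, hY, hf⟩ := exists_starP_chain a1 a2 hx.1
  have hxn := hx.1.2.1
  have hE : ∀ n : ℕ, epsP a1 a2 (Y (n + 1)) (idx ((n : ℤ) + 1)) = 0 := by
    refine epsP_chain_eq_zero a1 a2 ha1 ha (fun n => (hf n).1) hY hN fun n => ?_
    have h := hx.2 ((n : ℤ) + 1) (by omega)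
    rw [show ((n : ℤ) + 1).toNat = n + 1 by omega,
      show ((n : ℤ) + 1 - 1).toNat = n by omega] at h
    rw [Int.toNat_of_nonneg (hxn _), Int.toNat_of_nonneg (hxn _)]
    push_cast
    linarith
  rw [xstarFun_of_ZPlusMem a1 a2 hx.1, ← hY0] at hext ⊢
  set Z : ℕ → ℤ → ℤ := fun n =>
    eMposChain a1 a2 (fun m => (pseq a1 a2 k1 k2 m - x m).toNat) n fun _ => 0 with hZ
  have hZf : ∀ n, (Z n).support.Finite ∧ ∀ k, 1 ≤ k → Z n k = 0 := by
    intro n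
    induction n with
    | zero => simp [hZ, eMposChain]
    | succ n ih =>
      exact ⟨eMiter_support_finite a1 a2 ih.1 _ _, eMiter_eq_zero_of_pos a1 a2 ih.1 ih.2 _ _⟩
  have step : ∀ n : ℕ,
      SwPos a1 a2 μ n (some (combine (Y 0) fun _ => 0)) = some (combine (Y n) (Z n)) →
      pairW (wtZ a1 a2 μ (combine (Y n) (Z n))) (idx ((n : ℤ) + 1))
        = -ppos a1 a2 k1 k2 (n + 1) →
      x ((n : ℤ) + 1) ≤ pseq a1 a2 k1 k2 ((n : ℤ) + 1) ∧
      SwPos a1 a2 μ (n + 1) (some (combine (Y 0) fun _ => 0))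
        = some (combine (Y (n + 1)) (Z (n + 1))) := by
    intro n hS hw
    obtain ⟨js, hjs, hfold⟩ := exists_list_SwPos a1 a2 μ n (some (combine (Y 0) fun _ => 0))
    obtain ⟨b', hb', hb⟩ := hext js hjs
    rw [hfold, hS, Option.some_inj] at hb'
    subst hb'
    have hfn := (hb _ (isI_idx ((n : ℤ) + 1))).2 (by have := hp (n + 1); omega)
    rw [hY n] at hw hfn
    have := SiO_combine a1 a2 μ (hf (n + 1)).1 (hZf n).1 (hp (n + 1)) (hE n) hw hfn
    rw [Int.toNat_of_nonneg (hxn _), ← pseq_succ, ← hY n] at this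
    refine ⟨this.1, ?_⟩
    rw [SwPos, hS, this.2]
    rfl
  have main : ∀ n : ℕ,
      SwPos a1 a2 μ n (some (combine (Y 0) fun _ => 0)) = some (combine (Y n) (Z n)) ∧
      ePposChainO a1 a2 (fun m => (x m).toNat) n (some (Y 0)) = some (Y n) ∧
      pairW (wtZ a1 a2 μ (combine (Y n) (Z n))) (idx ((n : ℤ) + 1))
        = -ppos a1 a2 k1 k2 (n + 1) ∧
      pairW (wtZ a1 a2 μ (combine (Y n) (Z n))) (idx n) = ppos a1 a2 k1 k2 n := by
    intro n
    induction n with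
    | zero =>
      have hw := pairW_wtZ_xstarFun a1 a2 hx.1 (lamW k1 k2)
      rw [← hY0, ← hμ] at hw
      refine ⟨rfl, rfl, (hw _).trans ?_, (hw _).trans ?_⟩ <;> simp [lamW, pairW, idx, ppos]
    | succ n ih =>
      obtain ⟨i1, i2, i3, i4⟩ := ih
      obtain ⟨hle, hS⟩ := step n i1 i3
      have hw : ∀ r, pairW (wtZ a1 a2 μ (combine (Y (n + 1)) (Z (n + 1)))) (idx r)
          = pairW (wtZ a1 a2 μ (combine (Y n) (Z n))) (idx r)
            + ppos a1 a2 k1 k2 (n + 1) * pairJI a1 a2 ((n : ℤ) + 1) (idx r) := by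
        intro r
        have := pairW_wtZ_step a1 a2 μ (hf (n + 1)).1 (hZf n).1 (hf (n + 1)).2 (hZf n).2
          ((n : ℤ) + 1) r (x ((n : ℤ) + 1)).toNat
          (pseq a1 a2 k1 k2 ((n : ℤ) + 1) - x ((n : ℤ) + 1)).toNat
        rw [← hY n, Int.toNat_of_nonneg (hxn _), Int.toNat_of_nonneg (by omega),
          add_sub_cancel, pseq_succ] at this
        rw [← this]
        simp only [hZ, eMposChain, pseq_succ]
      refine ⟨hS, ?_, ?_, ?_⟩
      · rw [ePposChainO, i2, hY n]
        exact ePiterO_fPiter a1 a2 (hf (n + 1)).1 _ _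
      · rw [idx_eq_idx.mpr (show (((n + 1 : ℕ) : ℤ) + 1) % 2 = (n : ℤ) % 2 by push_cast; omega),
          hw, i4, pairJI_succ, ppos_succ_succ]
        ring
      · rw [Nat.cast_succ, hw, i3, pairJI_self a1 a2 rfl]
        ring
  obtain ⟨i1, -, i3, -⟩ := main n
  obtain ⟨j1, j2, -, -⟩ := main (n + 1)
  exact ⟨(step n i1 i3).1, Y (n + 1), j2, j1⟩

end HypCrystal

open HypCrystal in
theorem extremal_implies_xk_le_pk_and_Swk
    (a1 a2 : ℤ) (ha1 : 1 ≤ a1) (ha2 : 1 ≤ a2) (ha : 4 < a1 * a2)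
    (k1 k2 : ℤ) (hk1 : 0 < k1) (hk2 : 0 < k2)
    (hreg : 2 ≤ a1 → 2 ≤ a2 →
      (k2 ≤ k1 ∧ k1 < (a1 - 1) * k2) ∨ (k1 < k2 ∧ k2 ≤ (a2 - 1) * k1))
    (hdeg1 : a1 = 1 → 2 * k1 ≤ k2 ∧ k2 ≤ (a2 - 2) * k1)
    (hdeg2 : a2 = 1 → 2 * k2 ≤ k1 ∧ k1 ≤ (a1 - 2) * k2)
    (x : ℤ → ℤ) (hx : XPlusMem a1 a2 x)
    (hext : Extremal a1 a2 (mustar a1 a2 (lamW k1 k2) x) (xstarFun a1 a2 x)) :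
    ∀ k : ℤ, 1 ≤ k →
      x k ≤ pseq a1 a2 k1 k2 k ∧
      ∃ y : ℤ → ℤ,
        ePposChainO a1 a2 (fun m => (x m).toNat) k.toNat
            (some (starP a1 a2 x)) = some y ∧
        Swk a1 a2 (mustar a1 a2 (lamW k1 k2) x) k (some (xstarFun a1 a2 x)) =
          some (combine y
            (eMposChain a1 a2 (fun m => (pseq a1 a2 k1 k2 m - x m).toNat) k.toNat
              (fun _ => 0))) := by
  intro k hk
  obtain ⟨n, rfl⟩ : ∃ n : ℕ, k = (n : ℤ) + 1 := ⟨(k - 1).toNat, by omega⟩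
  have h := SwPos_xstar a1 a2 ha1 ha
    (ppos_pos a1 a2 ha1 ha2 ha k1 k2 hk1 hk2 hreg hdeg1 hdeg2) hx rfl hext n
  rw [Swk, if_pos (by omega), show ((n : ℤ) + 1).toNat = n + 1 by omega]
  exact h
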